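/- arXiv:2002.02768 — 2 statements merged into one kernel-verified Lean document; each statement's English description precedes it below -/
import Mathlib

section
/- Let n ≥ 2, let 𝓕 ⊆ M_n be a non-empty set of matrices, let 𝓕* = {A* : A ∈ 𝓕}, and let {B_1, …, B_r} be a basis of the complex linear span of 𝓕 ∪ 𝓕* consisting of Hermitian matrices. Then 𝓕 consists of mutually commuting normal matrices if and only if there is a Hermitian matrix C ∈ M_n with eigenvalues c_1 ≥ … ≥ c_n satisfying c_k > c_{k+1} for some positive integer k with n/2 − 1 ≤ k ≤ n/2 + 1, such that W_C(B_1, …, B_r) is polyhedral. -/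
open Matrix

/-- The joint `C`-numerical range of a tuple of matrices
`W_C(A_1, …, A_m) = {(tr(C U*A₁U), …, tr(C U*AₘU)) : U unitary} ⊆ ℂ^m`. -/
noncomputable def jointCNumRange {n m : ℕ} (C : Matrix (Fin n) (Fin n) ℂ)
    (A : Fin m → Matrix (Fin n) (Fin n) ℂ) : Set (Fin m → ℂ) :=
  { p | ∃ U ∈ Matrix.unitaryGroup (Fin n) ℂ, ∀ j, p j = (C * (star U * A j * U)).trace }

/-- A subset of a real vector space is polyhedral if it is the convex hull of a finite set. -/
def IsPolyhedral {E : Type*} [AddCommGroup E] [Module ℝ E] (S : Set E) : Prop :=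
  ∃ F : Set E, F.Finite ∧ S = convexHull ℝ F

section InvariantSubspaces

variable {E : Type*} [NormedAddCommGroup E] [InnerProductSpace ℂ E]

/-- The real quadratic form `x ↦ Re ⟪x, T x⟫`. -/
noncomputable def quadForm (T : E →ₗ[ℂ] E) (x : E) : ℝ := (inner ℂ x (T x)).re

/-- The member `s A + t B` of the real pencil spanned by `A` and `B`. -/
noncomputable def pencil (A B : E →ₗ[ℂ] E) (z : ℝ × ℝ) : E →ₗ[ℂ] E :=
  (z.1 : ℂ) • A + (z.2 : ℂ) • B

/-- The form of `T` on unit vectors of `R` dominates the form of `T` on unit vectors of `Rᗮ`. -/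
def Dominates (T : E →ₗ[ℂ] E) (R : Submodule ℂ E) : Prop :=
  ∀ x ∈ R, ∀ y ∈ Rᗮ, quadForm T y * ‖x‖ ^ 2 ≤ quadForm T x * ‖y‖ ^ 2

/-- The form of `T` is constant on the unit vectors of `V`. -/
def FormConstOn (T : E →ₗ[ℂ] E) (V : Submodule ℂ E) : Prop :=
  ∀ x ∈ V, ∀ y ∈ V, quadForm T y * ‖x‖ ^ 2 ≤ quadForm T x * ‖y‖ ^ 2

/-- `V` is invariant under both `A` and `B`. -/
def IsJointInvariant (A B : E →ₗ[ℂ] E) (V : Submodule ℂ E) : Prop :=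
  ∀ x ∈ V, A x ∈ V ∧ B x ∈ V

/-- `V` is a minimal nonzero subspace invariant under `A` and `B`. -/
def IsJointIrreducible (A B : E →ₗ[ℂ] E) (V : Submodule ℂ E) : Prop :=
  IsJointInvariant A B V ∧ V ≠ ⊥ ∧ ∀ U ≤ V, IsJointInvariant A B U → U = ⊥ ∨ U = V

lemma quadForm_pencil (A B : E →ₗ[ℂ] E) (z : ℝ × ℝ) (x : E) :
    quadForm (pencil A B z) x = z.1 * quadForm A x + z.2 * quadForm B x := by
  simp [quadForm, pencil]

lemma quadForm_pencil_neg (A B : E →ₗ[ℂ] E) (z : ℝ × ℝ) (x : E) :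
    quadForm (pencil A B (-z)) x = -quadForm (pencil A B z) x := by
  simp only [quadForm_pencil, Prod.fst_neg, Prod.snd_neg]
  ring

lemma isSymmetric_pencil {A B : E →ₗ[ℂ] E} (hA : A.IsSymmetric) (hB : B.IsSymmetric)
    (z : ℝ × ℝ) : (pencil A B z).IsSymmetric :=
  (hA.smul (by simp)).add (hB.smul (by simp))

lemma IsJointInvariant.pencil_mem {A B : E →ₗ[ℂ] E} {V : Submodule ℂ E} (hV : IsJointInvariant A B V)
    (z : ℝ × ℝ) {x : E} (hx : x ∈ V) : pencil A B z x ∈ V := by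
  exact V.add_mem (V.smul_mem (z.1 : ℂ) (hV x hx).1) (V.smul_mem (z.2 : ℂ) (hV x hx).2)

lemma IsJointInvariant.orthogonal {A B : E →ₗ[ℂ] E} (hA : A.IsSymmetric) (hB : B.IsSymmetric)
    {V : Submodule ℂ E} (hV : IsJointInvariant A B V) : IsJointInvariant A B Vᗮ := by
  intro x hx
  simp only [Submodule.mem_orthogonal] at hx ⊢
  refine ⟨fun u hu => ?_, fun u hu => ?_⟩
  · rw [← hA u x]; exact hx _ (hV u hu).1
  · rw [← hB u x]; exact hx _ (hV u hu).2

lemma IsJointInvariant.inf {A B : E →ₗ[ℂ] E} {V W : Submodule ℂ E} (hV : IsJointInvariant A B V)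
    (hW : IsJointInvariant A B W) : IsJointInvariant A B (V ⊓ W) := fun x hx =>
  ⟨⟨(hV x hx.1).1, (hW x hx.2).1⟩, ⟨(hV x hx.1).2, (hW x hx.2).2⟩⟩

lemma FormConstOn.exists_scalar {T : E →ₗ[ℂ] E} (hT : T.IsSymmetric) {V : Submodule ℂ E}
    (hTV : ∀ x ∈ V, T x ∈ V) (h : FormConstOn T V) : ∃ μ : ℝ, ∀ x ∈ V, T x = (μ : ℂ) • x := by
  rcases eq_or_ne V ⊥ with rfl | hV
  · exact ⟨0, fun x hx => by simp [(Submodule.mem_bot ℂ).1 hx]⟩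
  obtain ⟨y, hy, hy0⟩ := V.exists_mem_ne_zero_of_ne_bot hV
  have hyn : (0 : ℝ) < ‖y‖ ^ 2 := by positivity
  set μ : ℝ := quadForm T y / ‖y‖ ^ 2 with hμ
  have hinv : ∀ x ∈ V, (T - (μ : ℂ) • LinearMap.id : E →ₗ[ℂ] E) x ∈ V := fun x hx => by
    exact V.sub_mem (hTV x hx) (V.smul_mem (μ : ℂ) hx)
  have hS : (T - (μ : ℂ) • LinearMap.id : E →ₗ[ℂ] E).IsSymmetric :=
    hT.sub (LinearMap.IsSymmetric.id.smul (by simp))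
  have hzero : ∀ x ∈ V, quadForm T x = μ * ‖x‖ ^ 2 := fun x hx => by
    have := le_antisymm (h x hx y hy) (h y hy x hx)
    rw [hμ]; field_simp; linarith
  have h0 : (T - (μ : ℂ) • LinearMap.id : E →ₗ[ℂ] E).restrict hinv = 0 := by
    rw [← (hS.restrict_invariant hinv).inner_map_self_eq_zero]
    rintro ⟨x, hx⟩
    have him := hS.im_inner_apply_self x
    have hre := hzero x hx
    rw [Submodule.coe_inner]
    simp only [LinearMap.coe_restrict_apply]
    apply Complex.ext
    · rw [← inner_conj_symm]
      have hxx : (inner ℂ x x).re = ‖x‖ ^ 2 := inner_self_eq_norm_sq (𝕜 := ℂ) x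
      simp only [quadForm] at hre
      simp only [LinearMap.sub_apply, LinearMap.smul_apply, LinearMap.id_apply, inner_sub_right,
        inner_smul_right, Complex.conj_re, Complex.sub_re, Complex.re_ofReal_mul, hre, hxx,
        sub_self, Complex.zero_re]
    · simpa using him
  refine ⟨μ, fun x hx => ?_⟩
  have := congrArg Subtype.val (LinearMap.congr_fun h0 ⟨x, hx⟩)
  simpa [sub_eq_zero] using this

lemma IsJointInvariant.not_formConstOn {A B : E →ₗ[ℂ] E} (hA : A.IsSymmetric)
    (hB : B.IsSymmetric) {V : Submodule ℂ E} (hV : IsJointInvariant A B V) {x : E} (hx : x ∈ V)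
    (hne : A (B x) ≠ B (A x)) {z : ℝ × ℝ} (hz : z ≠ 0) : ¬ FormConstOn (pencil A B z) V := by
  intro h
  obtain ⟨μ, hμ⟩ := h.exists_scalar (isSymmetric_pencil hA hB z) (fun x hx => hV.pencil_mem z hx)
  have hy : ∀ y ∈ V, (z.1 : ℂ) • A y + (z.2 : ℂ) • B y = (μ : ℂ) • y := hμ
  have e0 := hy x hx
  have eA := hy _ (hV x hx).1
  have eB := hy _ (hV x hx).2
  have fA := congrArg A e0
  have fB := congrArg B e0
  simp only [map_add, map_smul] at fA fB
  have hA' : (z.2 : ℂ) • (A (B x) - B (A x)) = 0 := by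
    have := fA.trans eA.symm
    rw [smul_sub, sub_eq_zero]
    exact add_left_cancel this
  have hB' : (z.1 : ℂ) • (A (B x) - B (A x)) = 0 := by
    have := fB.trans eB.symm
    rw [smul_sub, sub_eq_zero]
    exact (add_right_cancel this).symm
  have hne' : A (B x) - B (A x) ≠ 0 := sub_ne_zero.2 hne
  apply hz
  ext
  · simpa [hne'] using hB'
  · simpa [hne'] using hA'

lemma isClosed_setOf_dominates (A B : E →ₗ[ℂ] E) (R : Submodule ℂ E) :
    IsClosed {z : ℝ × ℝ | Dominates (pencil A B z) R} := by
  simp only [Dominates, Set.ofPred_forall, quadForm_pencil]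
  refine isClosed_iInter fun x => isClosed_iInter fun _ => isClosed_iInter fun y =>
    isClosed_iInter fun _ => isClosed_le ?_ ?_ <;> fun_prop

lemma inf_eq_bot_of_dominates_neg {A B : E →ₗ[ℂ] E} {V R S : Submodule ℂ E} {z : ℝ × ℝ}
    (hc : ¬ FormConstOn (pencil A B z) V) (hR : Dominates (pencil A B z) R)
    (hS : Dominates (pencil A B (-z)) S) (hVR : V ≤ Rᗮ) (hVS : V ≤ Sᗮ) : R ⊓ S = ⊥ := by
  by_contra hne
  obtain ⟨w, ⟨hw1, hw2⟩, hw0⟩ := Submodule.exists_mem_ne_zero_of_ne_bot hne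
  have hwn : 0 < ‖w‖ ^ 2 := by positivity
  refine hc fun x hx y hy => ?_
  have h1 := hR w hw1 y (hVR hy)
  have h2 := hS w hw2 x (hVS hx)
  simp only [quadForm_pencil_neg] at h2
  refine le_of_mul_le_mul_right ?_ hwn
  nlinarith [mul_le_mul_of_nonneg_right h1 (sq_nonneg ‖x‖),
    mul_le_mul_of_nonneg_right h2 (sq_nonneg ‖y‖)]

lemma quadForm_smul_add_add_sub (T : E →ₗ[ℂ] E) (a b : ℂ) (x y : E) :
    quadForm T (a • x + b • y) + quadForm T (a • x - b • y) =
      2 * (‖a‖ ^ 2 * quadForm T x + ‖b‖ ^ 2 * quadForm T y) := by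
  have hq : ∀ (c : ℂ) (v : E), quadForm T (c • v) = ‖c‖ ^ 2 * quadForm T v := fun c v => by
    rw [quadForm, map_smul, inner_smul_left, inner_smul_right, ← mul_assoc, Complex.conj_mul',
      ← Complex.ofReal_pow, Complex.re_ofReal_mul, quadForm]
  rw [← hq, ← hq]
  simp only [quadForm, map_add, map_sub, inner_add_left, inner_add_right, inner_sub_left,
    inner_sub_right, Complex.add_re, Complex.sub_re]
  ring

lemma formConstOn_of_le_mean {T : E →ₗ[ℂ] E} {V : Submodule ℂ E} {e₁ e₂ : E} (h₁ : e₁ ∈ V)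
    (h₂ : e₂ ∈ V) (hn₁ : ‖e₁‖ = 1) (hn₂ : ‖e₂‖ = 1)
    (hspan : ∀ v ∈ V, ∃ a b : ℂ, v = a • e₁ + b • e₂) {μ : ℝ}
    (hμ : ∀ v ∈ V, quadForm T v ≤ μ * ‖v‖ ^ 2)
    (hmean : quadForm T e₁ + quadForm T e₂ = 2 * μ) : FormConstOn T V := by
  have hq₁ := hμ e₁ h₁
  have hq₂ := hμ e₂ h₂
  rw [hn₁] at hq₁
  rw [hn₂] at hq₂
  have heq : ∀ v ∈ V, quadForm T v = μ * ‖v‖ ^ 2 := by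
    intro v hv
    obtain ⟨a, b, rfl⟩ := hspan v hv
    have hq := quadForm_smul_add_add_sub T a b e₁ e₂
    have hp := parallelogram_law_with_norm ℂ (a • e₁) (b • e₂)
    rw [norm_smul, norm_smul, hn₁, hn₂] at hp
    have hs := hμ _ hv
    have hd := hμ _ (V.sub_mem (V.smul_mem a h₁) (V.smul_mem b h₂))
    have e₁' : quadForm T e₁ = μ := by linarith
    have e₂' : quadForm T e₂ = μ := by linarith
    rw [e₁', e₂'] at hq
    have hp' : μ * ‖a • e₁ + b • e₂‖ ^ 2 + μ * ‖a • e₁ - b • e₂‖ ^ 2 =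
        2 * (‖a‖ ^ 2 * μ + ‖b‖ ^ 2 * μ) := by linear_combination μ * hp
    linarith
  intro x hx y hy
  rw [heq x hx, heq y hy]
  exact le_of_eq (by ring)

variable [FiniteDimensional ℂ E]

lemma exists_isJointIrreducible_le (A B : E →ₗ[ℂ] E) {W : Submodule ℂ E} (hW : IsJointInvariant A B W)
    (hW0 : W ≠ ⊥) : ∃ V ≤ W, IsJointIrreducible A B V := by
  obtain ⟨V, ⟨hVW, hV, hV0⟩, hmin⟩ := wellFounded_lt.has_min
    {V : Submodule ℂ E | V ≤ W ∧ IsJointInvariant A B V ∧ V ≠ ⊥} ⟨W, le_rfl, hW, hW0⟩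
  refine ⟨V, hVW, hV, hV0, fun U hU hUi => ?_⟩
  by_contra! hcon
  exact hmin U ⟨hU.trans hVW, hUi, hcon.1⟩ (lt_of_le_of_ne hU hcon.2)

lemma exists_isJointIrreducible_not_commute {A B : E →ₗ[ℂ] E} (hA : A.IsSymmetric)
    (hB : B.IsSymmetric) (hAB : A ∘ₗ B ≠ B ∘ₗ A) :
    ∃ V, IsJointIrreducible A B V ∧ ∃ x ∈ V, A (B x) ≠ B (A x) := by
  obtain ⟨V, ⟨hV, x, hx, hne⟩, hmin⟩ := wellFounded_lt.has_min
    {V : Submodule ℂ E | IsJointInvariant A B V ∧ ∃ x ∈ V, A (B x) ≠ B (A x)} (by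
      obtain ⟨x, hx⟩ := DFunLike.ne_iff.1 hAB
      exact ⟨⊤, fun _ _ => ⟨trivial, trivial⟩, x, trivial, hx⟩)
  refine ⟨V, ⟨hV, ?_, fun U hU hUi => ?_⟩, x, hx, hne⟩
  · rintro rfl
    simp [(Submodule.mem_bot ℂ).1 hx] at hne
  by_contra! hcon
  have hcomm : ∀ W < V, IsJointInvariant A B W → ∀ y ∈ W, A (B y) = B (A y) := by
    intro W hW hWi y hy
    by_contra hy'
    exact hmin W ⟨hWi, y, hy, hy'⟩ hW
  have h1 := hcomm U (lt_of_le_of_ne hU hcon.2) hUi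
  have hne2 : V ⊓ Uᗮ ≠ V := by
    intro h
    refine hcon.1 ((Submodule.eq_bot_iff _).2 fun u hu => ?_)
    have : u ∈ Uᗮ := (inf_eq_left.1 h) (hU hu)
    exact inner_self_eq_zero.1 (this u hu)
  have h2 := hcomm (V ⊓ Uᗮ) (lt_of_le_of_ne inf_le_left hne2) (hV.inf (hUi.orthogonal hA hB))
  obtain ⟨u, hu, w, hw, rfl⟩ := U.exists_add_mem_mem_orthogonal x
  apply hne
  have hwV : w ∈ V := by simpa using V.sub_mem hx (hU hu)
  simp only [map_add, h1 u hu, h2 w ⟨hwV, hw⟩]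

/-- A form of Schur's lemma for the compression to an irreducible subspace of the projection onto
an invariant one. -/
lemma IsJointIrreducible.exists_projection_scalar {A B : E →ₗ[ℂ] E} (hA : A.IsSymmetric)
    (hB : B.IsSymmetric) {V R : Submodule ℂ E} (hV : IsJointIrreducible A B V)
    (hR : IsJointInvariant A B R) : ∃ τ : ℂ, ∀ x ∈ V,
      V.starProjection (R.starProjection x) = τ • x := by
  obtain ⟨hVi, hV0, hmin⟩ := hV
  have comm : ∀ W : Submodule ℂ E, IsJointInvariant A B W →
      ∀ x, W.starProjection (A x) = A (W.starProjection x) ∧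
        W.starProjection (B x) = B (W.starProjection x) := by
    intro W hW x
    obtain ⟨u, hu, w, hw, rfl⟩ := W.exists_add_mem_mem_orthogonal x
    have hW' := hW.orthogonal hA hB w hw
    simp only [map_add, Submodule.starProjection_eq_self_iff.2 hu,
      Submodule.starProjection_eq_self_iff.2 (hW u hu).1,
      Submodule.starProjection_eq_self_iff.2 (hW u hu).2,
      (Submodule.starProjection_apply_eq_zero_iff _).2 hw,
      (Submodule.starProjection_apply_eq_zero_iff _).2 hW'.1,
      (Submodule.starProjection_apply_eq_zero_iff _).2 hW'.2, map_zero, and_self]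
  let T : E →ₗ[ℂ] E := (V.starProjection : E →ₗ[ℂ] E) ∘ₗ (R.starProjection : E →ₗ[ℂ] E)
  have hT : ∀ x ∈ V, T x ∈ V := fun x _ => Submodule.starProjection_apply_mem _ _
  have : Nontrivial V := Submodule.nontrivial_iff_ne_bot.2 hV0
  obtain ⟨τ, hτ⟩ := Module.End.exists_eigenvalue (T.restrict hT)
  obtain ⟨v, hv⟩ := hτ.exists_hasEigenvector
  have hvT : T v = τ • (v : E) := congrArg Subtype.val hv.apply_eq_smul
  refine ⟨τ, ?_⟩
  let U : Submodule ℂ E := V ⊓ Module.End.eigenspace T τ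
  have hU : IsJointInvariant A B U := by
    rintro x ⟨hx, hxT⟩
    rw [SetLike.mem_coe, Module.End.mem_eigenspace_iff] at hxT
    have hxT' : V.starProjection (R.starProjection x) = τ • x := hxT
    refine ⟨⟨(hVi x hx).1, ?_⟩, ⟨(hVi x hx).2, ?_⟩⟩ <;>
    · rw [SetLike.mem_coe, Module.End.mem_eigenspace_iff]
      simp [T, comm R hR, comm V hVi, hxT']
  rcases hmin U inf_le_left hU with h | h
  · have : (v : E) ∈ U := ⟨v.2, Module.End.mem_eigenspace_iff.2 hvT⟩
    rw [h, Submodule.mem_bot] at this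
    exact absurd (Subtype.ext this) hv.2
  · intro x hx
    rw [← h] at hx
    exact Module.End.mem_eigenspace_iff.1 hx.2

lemma IsJointInvariant.quadForm_decompose {A B : E →ₗ[ℂ] E} (hA : A.IsSymmetric)
    (hB : B.IsSymmetric) {R : Submodule ℂ E} (hR : IsJointInvariant A B R) (z : ℝ × ℝ) (x : E) :
    quadForm (pencil A B z) x = quadForm (pencil A B z) (R.starProjection x) +
      quadForm (pencil A B z) (Rᗮ.starProjection x) := by
  have hu := R.starProjection_apply_mem x
  have hw := Rᗮ.starProjection_apply_mem x
  nth_rewrite 1 [← R.starProjection_add_starProjection_orthogonal x]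
  set u := R.starProjection x
  set w := Rᗮ.starProjection x
  have h1 : inner ℂ u (pencil A B z w) = 0 := (hR.orthogonal hA hB).pencil_mem z hw u hu
  have h2 : inner ℂ w (pencil A B z u) = 0 :=
    Submodule.inner_left_of_mem_orthogonal (hR.pencil_mem z hu) hw
  simp only [quadForm, map_add, inner_add_left, inner_add_right, h1, h2, add_zero, zero_add,
    Complex.add_re]

lemma IsJointIrreducible.exists_weight {A B : E →ₗ[ℂ] E} (hA : A.IsSymmetric)
    (hB : B.IsSymmetric) {V R : Submodule ℂ E} (hV : IsJointIrreducible A B V)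
    (hR : IsJointInvariant A B R) : ∃ τ : ℝ, 0 ≤ τ ∧ τ ≤ 1 ∧ ∀ x ∈ V,
      ‖R.starProjection x‖ ^ 2 = τ * ‖x‖ ^ 2 ∧
      ‖Rᗮ.starProjection x‖ ^ 2 = (1 - τ) * ‖x‖ ^ 2 ∧ ∀ z,
      quadForm (pencil A B z) (R.starProjection x) = τ * quadForm (pencil A B z) x ∧
      quadForm (pencil A B z) (Rᗮ.starProjection x) = (1 - τ) * quadForm (pencil A B z) x := by
  obtain ⟨τ, hτ⟩ := hV.exists_projection_scalar hA hB hR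
  have key : ∀ x ∈ V, ∀ y ∈ V, inner ℂ (R.starProjection x) y =
      (starRingEnd ℂ) τ * inner ℂ x y := by
    intro x hx y hy
    rw [← inner_smul_left, ← hτ x hx, Submodule.inner_starProjection_left_eq_right V,
      Submodule.starProjection_eq_self_iff.2 hy]
  have hself : ∀ x, inner ℂ (R.starProjection x) x = ((‖R.starProjection x‖ ^ 2 : ℝ) : ℂ) := by
    intro x
    have h := inner_self_eq_norm_sq_to_K (𝕜 := ℂ) (R.starProjection x)
    rw [Submodule.inner_starProjection_left_eq_right,
      Submodule.starProjection_eq_self_iff.2 (R.starProjection_apply_mem x),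
      ← Submodule.inner_starProjection_left_eq_right] at h
    rw [h]
    push_cast
    rfl
  obtain ⟨v, hv, hv0⟩ := V.exists_mem_ne_zero_of_ne_bot hV.2.1
  have hvn : (0 : ℝ) < ‖v‖ ^ 2 := by positivity
  have hcast : ∀ x : E, inner ℂ x x = ((‖x‖ ^ 2 : ℝ) : ℂ) := fun x => by
    rw [inner_self_eq_norm_sq_to_K]; push_cast; rfl
  have him : τ.im = 0 := by
    have h := key v hv v hv
    rw [hself, hcast] at h
    have := congrArg Complex.im h
    simp only [Complex.ofReal_im, Complex.mul_im, Complex.conj_im, Complex.ofReal_re,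
      mul_zero, zero_add] at this
    rcases mul_eq_zero.1 this.symm with h | h
    · simpa using h
    · exact absurd h hvn.ne'
  have hτr : (starRingEnd ℂ) τ = (τ.re : ℂ) := by
    apply Complex.ext <;> simp [him]
  have hnorm : ∀ x ∈ V, ‖R.starProjection x‖ ^ 2 = τ.re * ‖x‖ ^ 2 := by
    intro x hx
    have h := key x hx x hx
    rw [hself, hcast, hτr] at h
    exact_mod_cast h
  have hsplit : ∀ x, ‖x‖ ^ 2 = ‖R.starProjection x‖ ^ 2 + ‖Rᗮ.starProjection x‖ ^ 2 :=
    fun x => Submodule.norm_sq_eq_add_norm_sq_starProjection x R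
  refine ⟨τ.re, ?_, ?_, fun x hx => ⟨hnorm x hx, ?_, fun z => ?_⟩⟩
  · have := hnorm v hv
    by_contra! h
    nlinarith [sq_nonneg ‖R.starProjection v‖]
  · have := hnorm v hv
    have := hsplit v
    by_contra! h
    nlinarith [sq_nonneg ‖Rᗮ.starProjection v‖]
  · linarith [hsplit x, hnorm x hx]
  · have hx' : quadForm (pencil A B z) (R.starProjection x) =
        τ.re * quadForm (pencil A B z) x := by
      have hH : pencil A B z (R.starProjection x) = R.starProjection (pencil A B z x) := by
        have hu := hR.pencil_mem z (R.starProjection_apply_mem x)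
        have hw := (hR.orthogonal hA hB).pencil_mem z (Rᗮ.starProjection_apply_mem x)
        nth_rewrite 2 [← R.starProjection_add_starProjection_orthogonal x]
        rw [map_add, map_add, Submodule.starProjection_eq_self_iff.2 hu,
          (Submodule.starProjection_apply_eq_zero_iff _).2 hw, add_zero]
      rw [quadForm, hH, ← Submodule.inner_starProjection_left_eq_right,
        Submodule.starProjection_eq_self_iff.2 (R.starProjection_apply_mem x),
        key x hx _ (hV.1.pencil_mem z hx), hτr, Complex.re_ofReal_mul, quadForm]
    exact ⟨hx', by linarith [hR.quadForm_decompose hA hB z x]⟩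

lemma IsJointIrreducible.le_or_le_orthogonal {A B : E →ₗ[ℂ] E} (hA : A.IsSymmetric)
    (hB : B.IsSymmetric) {V R : Submodule ℂ E} (hV : IsJointIrreducible A B V)
    (hR : IsJointInvariant A B R) {z : ℝ × ℝ} (hd : Dominates (pencil A B z) R)
    (hc : ¬ FormConstOn (pencil A B z) V) : V ≤ R ∨ V ≤ Rᗮ := by
  obtain ⟨τ, h0, h1, h⟩ := hV.exists_weight hA hB hR
  rcases h0.eq_or_lt with rfl | h0
  · right
    intro x hx
    have := (h x hx).1
    rw [← Submodule.starProjection_apply_eq_zero_iff, ← norm_eq_zero]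
    simpa using this
  rcases h1.eq_or_lt with rfl | h1
  · left
    intro x hx
    have := (h x hx).2.1
    rw [← R.orthogonal_orthogonal, ← Submodule.starProjection_apply_eq_zero_iff, ← norm_eq_zero]
    simpa using this
  refine absurd (fun x hx y hy => ?_) hc
  have hxy := hd _ (R.starProjection_apply_mem x) _ (Rᗮ.starProjection_apply_mem y)
  rw [(h x hx).1, (h y hy).2.1, ((h x hx).2.2 z).1, ((h y hy).2.2 z).2] at hxy
  have hpos : 0 < τ * (1 - τ) := mul_pos h0 (by linarith)
  refine le_of_mul_le_mul_left ?_ hpos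
  linarith

lemma Dominates.pencil_neg {A B : E →ₗ[ℂ] E} {R : Submodule ℂ E} {z : ℝ × ℝ}
    (h : Dominates (pencil A B z) R) : Dominates (pencil A B (-z)) Rᗮ := by
  intro x hx y hy
  rw [R.orthogonal_orthogonal] at hy
  have := h y hy x hx
  simp only [quadForm_pencil_neg]
  linarith

/-- An irreducible subspace on which `A` and `B` do not commute lies on the same side of every
dominating subspace. -/
lemma IsJointIrreducible.forall_le_or_forall_le_orthogonal {ι : Type*} [Finite ι]
    {A B : E →ₗ[ℂ] E} (hA : A.IsSymmetric) (hB : B.IsSymmetric) {R : ι → Submodule ℂ E} {k : ℕ}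
    (hR : ∀ i, IsJointInvariant A B (R i)) (hk : ∀ i, Module.finrank ℂ (R i) = k)
    (hdom : ∀ z, ∃ i, Dominates (pencil A B z) (R i)) {V : Submodule ℂ E}
    (hV : IsJointIrreducible A B V) (hc : ∀ z ≠ 0, ¬ FormConstOn (pencil A B z) V) :
    (∀ z ≠ 0, ∀ i, Dominates (pencil A B z) (R i) → V ≤ R i) ∨
      (∀ z ≠ 0, ∀ i, Dominates (pencil A B z) (R i) → V ≤ (R i)ᗮ) := by
  have hor : ∀ z ≠ 0, ∀ i, Dominates (pencil A B z) (R i) → V ≤ R i ∨ V ≤ (R i)ᗮ :=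
    fun z hz i hd => hV.le_or_le_orthogonal hA hB (hR i) hd (hc z hz)
  by_contra! hcon
  obtain ⟨⟨z₁, hz₁, i₁, hd₁, hi₁⟩, z₂, hz₂, i₂, hd₂, hi₂⟩ := hcon
  have hclosed : ∀ p : ι → Prop,
      IsClosed (⋃ i : {i // p i}, {z : ℝ × ℝ | Dominates (pencil A B z) (R i)}) :=
    fun p => isClosed_iUnion_of_finite fun i => isClosed_setOf_dominates A B (R i)
  have hconn : IsPreconnected ({0}ᶜ : Set (ℝ × ℝ)) :=
    (isConnected_compl_singleton_of_one_lt_rank (by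
      rw [rank_prod']; norm_num) 0).isPreconnected
  obtain ⟨z, hz, h₁, h₂⟩ := isPreconnected_closed_iff.1 hconn _ _
    (hclosed fun i => V ≤ R i) (hclosed fun i => V ≤ (R i)ᗮ) (fun z hz => by
      obtain ⟨i, hi⟩ := hdom z
      rcases hor z hz i hi with h | h
      · exact Or.inl (Set.mem_iUnion.2 ⟨⟨i, h⟩, hi⟩)
      · exact Or.inr (Set.mem_iUnion.2 ⟨⟨i, h⟩, hi⟩))
    ⟨z₂, hz₂, Set.mem_iUnion.2 ⟨⟨i₂, (hor z₂ hz₂ i₂ hd₂).resolve_right hi₂⟩, hd₂⟩⟩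
    ⟨z₁, hz₁, Set.mem_iUnion.2 ⟨⟨i₁, (hor z₁ hz₁ i₁ hd₁).resolve_left hi₁⟩, hd₁⟩⟩
  obtain ⟨⟨i, hi⟩, hdi⟩ := Set.mem_iUnion.1 h₁
  obtain ⟨⟨j, hj⟩, hdj⟩ := Set.mem_iUnion.1 h₂
  simp only [Set.mem_ofPred_eq] at hdi hdj
  obtain ⟨w, ⟨hw1, hw2⟩, hw0⟩ : ∃ w ∈ (R i)ᗮ ⊓ R j, w ≠ 0 := by
    apply Submodule.exists_mem_ne_zero_of_ne_bot
    intro hbot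
    have hsum := Submodule.finrank_sup_add_finrank_inf_eq (R i)ᗮ (R j)
    have hi' := (R i).finrank_add_finrank_orthogonal
    rw [hbot, finrank_bot, hk j] at hsum
    rw [hk i] at hi'
    have htop : (R i)ᗮ ⊔ R j = ⊤ := Submodule.eq_top_of_finrank_eq (by omega)
    obtain ⟨v, hv, hv0⟩ := V.exists_mem_ne_zero_of_ne_bot hV.2.1
    have : v ∈ ((R i)ᗮ ⊔ R j)ᗮ := by
      rw [← Submodule.inf_orthogonal, Submodule.orthogonal_orthogonal]
      exact ⟨hi hv, hj hv⟩
    rw [htop, Submodule.top_orthogonal_eq_bot] at this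
    exact hv0 this
  have hwn : 0 < ‖w‖ ^ 2 := by positivity
  refine hc z hz fun x hx y hy => ?_
  have h1 := hdi x (hi hx) w hw1
  have h2 := hdj w hw2 y (hj hy)
  refine le_of_mul_le_mul_right ?_ hwn
  nlinarith [mul_le_mul_of_nonneg_right h1 (sq_nonneg ‖y‖),
    mul_le_mul_of_nonneg_right h2 (sq_nonneg ‖x‖)]

lemma two_le_finrank_of_not_formConstOn {T : E →ₗ[ℂ] E} {V : Submodule ℂ E}
    (hc : ¬ FormConstOn T V) : 2 ≤ Module.finrank ℂ V := by
  by_contra! hlt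
  obtain ⟨v, hv⟩ := finrank_le_one_iff.1 (Nat.lt_succ_iff.1 hlt)
  refine hc fun x hx y hy => ?_
  obtain ⟨a, ha⟩ := hv ⟨x, hx⟩
  obtain ⟨b, hb⟩ := hv ⟨y, hy⟩
  obtain rfl : a • (v : E) = x := congrArg Subtype.val ha
  obtain rfl : b • (v : E) = y := congrArg Subtype.val hb
  have hq : ∀ c : ℂ, quadForm T (c • (v : E)) = ‖c‖ ^ 2 * quadForm T v := fun c => by
    rw [quadForm, map_smul, inner_smul_left, inner_smul_right, ← mul_assoc, Complex.conj_mul',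
      ← Complex.ofReal_pow, Complex.re_ofReal_mul, quadForm]
  simp only [hq, norm_smul]
  exact le_of_eq (by ring)

lemma IsJointIrreducible.not_forall_le_orthogonal {ι : Type*}
    {A B : E →ₗ[ℂ] E} (hA : A.IsSymmetric) (hB : B.IsSymmetric) {R : ι → Submodule ℂ E} {k : ℕ}
    (hR : ∀ i, IsJointInvariant A B (R i)) (hk : ∀ i, Module.finrank ℂ (R i) = k)
    (hdom : ∀ z, ∃ i, Dominates (pencil A B z) (R i)) {V : Submodule ℂ E}
    (hV : IsJointIrreducible A B V) (hc : ∀ z ≠ 0, ¬ FormConstOn (pencil A B z) V)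
    (hk0 : 1 ≤ k) (hn : Module.finrank ℂ E ≤ 2 * k + 2) :
    ¬ ∀ z ≠ 0, ∀ i, Dominates (pencil A B z) (R i) → V ≤ (R i)ᗮ := by
  intro hL
  have hV2 : 2 ≤ Module.finrank ℂ V := two_le_finrank_of_not_formConstOn (hc (1, 0) (by simp))
  have hsup : ∀ z ≠ 0, ∀ i j, Dominates (pencil A B z) (R i) →
      Dominates (pencil A B (-z)) (R j) →
      V = (R i ⊔ R j)ᗮ ∧ Module.finrank ℂ V = 2 := by
    intro z hz i j hi hj
    have hVi := hL z hz i hi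
    have hVj := hL (-z) (neg_ne_zero.2 hz) j hj
    have hinf := inf_eq_bot_of_dominates_neg (hc z hz) hi hj hVi hVj
    have hsum := Submodule.finrank_sup_add_finrank_inf_eq (R i) (R j)
    rw [hinf, finrank_bot, hk, hk] at hsum
    have horth := (R i ⊔ R j).finrank_add_finrank_orthogonal
    have hle : V ≤ (R i ⊔ R j)ᗮ := by
      rw [← Submodule.inf_orthogonal]
      exact le_inf hVi hVj
    have := Submodule.finrank_mono hle
    exact ⟨Submodule.eq_of_le_of_finrank_le hle (by omega), by omega⟩
  obtain ⟨i₀, hi₀⟩ := hdom (1, 0)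
  obtain ⟨j₀, hj₀⟩ := hdom (-(1, 0))
  have hfin := (hsup (1, 0) (by simp) i₀ j₀ hi₀ hj₀).2
  have hVo : Vᗮ ≠ ⊥ := by
    intro h
    have h1 := hL (1, 0) (by simp) i₀ hi₀
    have h2 := (R i₀).finrank_add_finrank_orthogonal
    have h3 := V.finrank_add_finrank_orthogonal
    have h4 := Submodule.finrank_mono h1
    rw [h, finrank_bot] at h3
    rw [hk] at h2
    omega
  obtain ⟨W, hWV, hW⟩ := exists_isJointIrreducible_le A B (hV.1.orthogonal hA hB) hVo
  obtain ⟨w, hw, hw0⟩ := W.exists_mem_ne_zero_of_ne_bot hW.2.1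
  have hwn : 0 < ‖w‖ ^ 2 := by positivity
  let e := (stdOrthonormalBasis ℂ V).reindex (finCongr hfin)
  have hspan : ∀ v ∈ V, ∃ a b : ℂ, v = a • (e 0 : E) + b • (e 1 : E) := by
    intro v hv
    refine ⟨inner ℂ (e 0) ⟨v, hv⟩, inner ℂ (e 1) ⟨v, hv⟩, ?_⟩
    have := congrArg Subtype.val (e.sum_repr' ⟨v, hv⟩)
    rw [Fin.sum_univ_two] at this
    exact this.symm
  have hnorm : ∀ i, ‖(e i : E)‖ = 1 := fun i => e.orthonormal.1 i
  have hclaim : ∀ z ≠ 0, ∀ i, Dominates (pencil A B z) (R i) →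
      (quadForm (pencil A B z) (e 0) + quadForm (pencil A B z) (e 1)) * ‖w‖ ^ 2 =
        2 * quadForm (pencil A B z) w → W ≤ (R i)ᗮ := by
    intro z hz i hd hz0
    obtain ⟨τ, h0, h1, h⟩ := hW.exists_weight hA hB (hR i)
    rcases h0.eq_or_lt with rfl | h0
    · intro x hx
      have := (h x hx).1
      rw [← Submodule.starProjection_apply_eq_zero_iff, ← norm_eq_zero]
      simpa using this
    refine absurd (formConstOn_of_le_mean (e 0).2 (e 1).2 (hnorm 0) (hnorm 1) hspan
      (μ := quadForm (pencil A B z) w / ‖w‖ ^ 2) ?_ ?_) (hc z hz)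
    · intro v hv
      have := hd _ ((R i).starProjection_apply_mem w) v (hL z hz i hd hv)
      rw [(h w hw).1, ((h w hw).2.2 z).1] at this
      rw [div_mul_eq_mul_div, le_div_iff₀ hwn]
      refine le_of_mul_le_mul_left ?_ h0
      linarith
    · field_simp
      linarith
  obtain ⟨z, hz, hz0⟩ : ∃ z : ℝ × ℝ, z ≠ 0 ∧
      (quadForm (pencil A B z) (e 0) + quadForm (pencil A B z) (e 1)) * ‖w‖ ^ 2 =
        2 * quadForm (pencil A B z) w := by
    simp only [quadForm_pencil]
    set a := (quadForm A (e 0) + quadForm A (e 1)) * ‖w‖ ^ 2 - 2 * quadForm A w with ha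
    set b := (quadForm B (e 0) + quadForm B (e 1)) * ‖w‖ ^ 2 - 2 * quadForm B w with hb
    by_cases h : a = 0 ∧ b = 0
    · exact ⟨(1, 0), by simp, by linear_combination h.1 - ha⟩
    · refine ⟨(-b, a), fun h' => h ?_, by linear_combination b * ha - a * hb⟩
      simp only [Prod.mk_eq_zero, neg_eq_zero] at h'
      exact h'.symm
  obtain ⟨i, hi⟩ := hdom z
  obtain ⟨j, hj⟩ := hdom (-z)
  have hWi := hclaim z hz i hi hz0
  have hWj := hclaim (-z) (neg_ne_zero.2 hz) j hj (by
    simp only [quadForm_pencil_neg]; linarith)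
  have hWV' : W ≤ V := by
    rw [(hsup z hz i j hi hj).1, ← Submodule.inf_orthogonal]
    exact le_inf hWi hWj
  exact hw0 (inner_self_eq_zero.1 (hWV hw w (hWV' hw)))

/-- If for every member of a real pencil of symmetric operators one of finitely many invariant
subspaces, of a common dimension close to half the full one, is dominating, then the pencil is
commutative. -/
theorem commute_of_dominates {ι : Type*} [Finite ι] {A B : E →ₗ[ℂ] E} (hA : A.IsSymmetric)
    (hB : B.IsSymmetric) {R : ι → Submodule ℂ E} {k : ℕ}
    (hR : ∀ i, IsJointInvariant A B (R i)) (hk : ∀ i, Module.finrank ℂ (R i) = k)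
    (hdom : ∀ z, ∃ i, Dominates (pencil A B z) (R i)) (hk0 : 1 ≤ k)
    (hkn : k + 1 ≤ Module.finrank ℂ E) (hlow : Module.finrank ℂ E ≤ 2 * k + 2)
    (hup : 2 * k ≤ Module.finrank ℂ E + 2) : A ∘ₗ B = B ∘ₗ A := by
  by_contra hne
  obtain ⟨V, hV, x, hx, hxne⟩ := exists_isJointIrreducible_not_commute hA hB hne
  have hc : ∀ z ≠ 0, ¬ FormConstOn (pencil A B z) V :=
    fun z hz => hV.1.not_formConstOn hA hB hx hxne hz
  rcases hV.forall_le_or_forall_le_orthogonal hA hB hR hk hdom hc with hT | hL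
  · refine hV.not_forall_le_orthogonal hA hB (R := fun i => (R i)ᗮ)
      (k := Module.finrank ℂ E - k) (fun i => (hR i).orthogonal hA hB) (fun i => ?_)
      (fun z => ?_) hc (by omega) (by omega) (fun z hz i hd => ?_)
    · have := (R i).finrank_add_finrank_orthogonal
      rw [hk] at this
      omega
    · obtain ⟨i, hi⟩ := hdom (-z)
      exact ⟨i, by simpa using hi.pencil_neg⟩
    · rw [(R i).orthogonal_orthogonal]
      have := hd.pencil_neg
      rw [(R i).orthogonal_orthogonal] at this
      exact hT (-z) (neg_ne_zero.2 hz) i this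
  · exact hV.not_forall_le_orthogonal hA hB hR hk hdom hc hk0 hlow hL

end InvariantSubspaces

section Maximizers

variable {E : Type*} [NormedAddCommGroup E] [InnerProductSpace ℂ E]

/-- The operator with eigenbasis `b` and eigenvalues `c`. -/
noncomputable def diagOperator {m : ℕ} (b : OrthonormalBasis (Fin m) ℂ E) (c : Fin m → ℝ) :
    E →ₗ[ℂ] E :=
  ∑ p, (c p : ℂ) • ((innerSL ℂ (b p)).toLinearMap.smulRight (b p))

lemma diagOperator_apply {m : ℕ} (b : OrthonormalBasis (Fin m) ℂ E) (c : Fin m → ℝ) (x : E) :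
    diagOperator b c x = ∑ p, (c p : ℂ) • inner ℂ (b p) x • b p := by
  simp [diagOperator, LinearMap.sum_apply]

lemma diagOperator_basis {m : ℕ} (b : OrthonormalBasis (Fin m) ℂ E) (c : Fin m → ℝ) (q : Fin m) :
    diagOperator b c (b q) = (c q : ℂ) • b q := by
  simp [diagOperator_apply, b.inner_eq_ite]

lemma isSymmetric_diagOperator {m : ℕ} (b : OrthonormalBasis (Fin m) ℂ E) (c : Fin m → ℝ) :
    (diagOperator b c).IsSymmetric := by
  intro x y
  simp only [diagOperator_apply, sum_inner, inner_sum, inner_smul_left, inner_smul_right,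
    Complex.conj_ofReal, inner_conj_symm]
  exact Finset.sum_congr rfl fun p _ => by ring

lemma quadForm_two_smul_sub {H : E →ₗ[ℂ] E} (hH : H.IsSymmetric) (a : ℂ) (v x : E) :
    quadForm H ((2 * a) • v - x) =
      4 * ‖a‖ ^ 2 * quadForm H v - 4 * (a * inner ℂ x (H v)).re + quadForm H x := by
  have h : inner ℂ v (H x) = (starRingEnd ℂ) (inner ℂ x (H v)) := by
    rw [← hH v x, inner_conj_symm]
  have him : (inner ℂ v (H v)).im = 0 := by
    rw [← Complex.conj_eq_iff_im, inner_conj_symm, hH]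
  simp only [quadForm, map_sub, map_smul, inner_sub_left, inner_sub_right, inner_smul_left,
    inner_smul_right, h, Complex.sq_norm, Complex.normSq_apply, map_mul, Complex.sub_re,
    Complex.mul_re, Complex.mul_im, Complex.conj_re, Complex.conj_im, him]
  norm_num
  linear_combination (-4 * a.re * a.im) * him

lemma covariance_nonneg_of_isMax {m : ℕ} {b : OrthonormalBasis (Fin m) ℂ E} {c : Fin m → ℝ}
    {H : E →ₗ[ℂ] E} (hH : H.IsSymmetric) (hmax : ∀ b' : OrthonormalBasis (Fin m) ℂ E,
      ∑ p, c p * quadForm H (b' p) ≤ ∑ p, c p * quadForm H (b p)) {v : E} (hv : ‖v‖ = 1) :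
    quadForm (diagOperator b c) v * quadForm H v ≤
      (inner ℂ (diagOperator b c v) (H v)).re := by
  have h := hmax (b.map (Submodule.reflection (ℂ ∙ v)))
  have hrefl : ∀ x, Submodule.reflection (ℂ ∙ v) x = (2 * inner ℂ v x) • v - x := fun x => by
    rw [Submodule.reflection_singleton_apply, hv]
    simp [two_smul, two_mul, add_smul]
  have hX : quadForm (diagOperator b c) v = ∑ p, c p * ‖inner ℂ v (b p)‖ ^ 2 := by
    simp only [quadForm, diagOperator_apply, inner_sum, inner_smul_right, Complex.re_sum,
      Complex.re_ofReal_mul]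
    refine Finset.sum_congr rfl fun p _ => ?_
    rw [← inner_conj_symm (b p) v, Complex.conj_mul', ← Complex.ofReal_pow, Complex.ofReal_re]
  have hXH : (inner ℂ (diagOperator b c v) (H v)).re =
      ∑ p, c p * (inner ℂ v (b p) * inner ℂ (b p) (H v)).re := by
    simp only [diagOperator_apply, sum_inner, inner_smul_left, Complex.re_sum,
      Complex.conj_ofReal, inner_conj_symm, Complex.re_ofReal_mul]
  simp only [OrthonormalBasis.map_apply, hrefl, quadForm_two_smul_sub hH] at h
  have hsum : ∑ p, c p * (4 * ‖inner ℂ v (b p)‖ ^ 2 * quadForm H v -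
      4 * (inner ℂ v (b p) * inner ℂ (b p) (H v)).re + quadForm H (b p)) =
      4 * (∑ p, c p * ‖inner ℂ v (b p)‖ ^ 2) * quadForm H v -
        4 * (∑ p, c p * (inner ℂ v (b p) * inner ℂ (b p) (H v)).re) +
        ∑ p, c p * quadForm H (b p) := by
    simp only [Finset.mul_sum, Finset.sum_mul, ← Finset.sum_sub_distrib, ← Finset.sum_add_distrib]
    exact Finset.sum_congr rfl fun p _ => by ring
  rw [hsum, ← hX, ← hXH] at h
  linarith

/-- The covariance of `X` and `H` is nonnegative in every state. -/
def CovarianceNonneg (X H : E →ₗ[ℂ] E) : Prop :=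
  ∀ v, quadForm X v * quadForm H v ≤ ‖v‖ ^ 2 * (inner ℂ (X v) (H v)).re

lemma covarianceNonneg_of_isMax {m : ℕ} {b : OrthonormalBasis (Fin m) ℂ E} {c : Fin m → ℝ}
    {H : E →ₗ[ℂ] E} (hH : H.IsSymmetric) (hmax : ∀ b' : OrthonormalBasis (Fin m) ℂ E,
      ∑ p, c p * quadForm H (b' p) ≤ ∑ p, c p * quadForm H (b p)) :
    CovarianceNonneg (diagOperator b c) H := by
  intro v
  rcases eq_or_ne v 0 with rfl | hv
  · simp [quadForm]
  obtain ⟨u, hu, hvu⟩ : ∃ u : E, ‖u‖ = 1 ∧ v = (‖v‖ : ℂ) • u :=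
    ⟨((‖v‖⁻¹ : ℝ) : ℂ) • v, by simp [norm_smul, hv], by simp [smul_smul, hv]⟩
  have h := covariance_nonneg_of_isMax hH hmax hu
  have hq : ∀ (r : ℝ) (S T : E →ₗ[ℂ] E), (inner ℂ (S ((r : ℂ) • u)) (T ((r : ℂ) • u))).re =
      r ^ 2 * (inner ℂ (S u) (T u)).re := fun r S T => by
    rw [map_smul, map_smul, inner_smul_left, inner_smul_right, ← mul_assoc, Complex.conj_mul',
      ← Complex.ofReal_pow, Complex.re_ofReal_mul]
    simp
  have hq1 := fun T => hq ‖v‖ LinearMap.id T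
  simp only [LinearMap.id_apply, ← hvu] at hq1
  have hq2 := hq ‖v‖ (diagOperator b c) H
  rw [← hvu] at hq2
  simp only [quadForm] at h ⊢
  rw [hq1, hq1, hq2]
  have := mul_le_mul_of_nonneg_left h (sq_nonneg (‖v‖ ^ 2))
  linarith

variable [FiniteDimensional ℂ E]

lemma CovarianceNonneg.apply_eq_zero {X H : E →ₗ[ℂ] E} (hX : X.IsSymmetric)
    (h : CovarianceNonneg X H) {b : E} (hb : X b = 0) : X (H b) = 0 := by
  have hre : ∀ w, 0 ≤ (inner ℂ (X w) (H b)).re := by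
    intro w
    have hXc : Continuous X := X.continuous_of_finiteDimensional
    have hHc : Continuous H := H.continuous_of_finiteDimensional
    let v : ℝ → E := fun t => b + (t : ℂ) • w
    have hvc : Continuous v := by fun_prop
    have hineq : ∀ t > 0, t * quadForm X w * quadForm H (v t) ≤
        ‖v t‖ ^ 2 * (inner ℂ (X w) (H (v t))).re := by
      intro t ht
      have hv := h (v t)
      have hXv : X (v t) = (t : ℂ) • X w := by simp [v, hb]
      have h1 : quadForm X (v t) = t ^ 2 * quadForm X w := by
        have : inner ℂ b (X w) = 0 := by rw [← hX b w, hb, inner_zero_left]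
        rw [quadForm, hXv]
        simp only [v, inner_add_left, inner_smul_left, inner_smul_right, this, zero_add,
          Complex.conj_ofReal, Complex.re_ofReal_mul, quadForm]
        ring
      rw [h1, hXv, inner_smul_left, Complex.conj_ofReal, Complex.re_ofReal_mul] at hv
      refine le_of_mul_le_mul_left ?_ ht
      linarith
    have hcl : IsClosed {t : ℝ | t * quadForm X w * quadForm H (v t) ≤
        ‖v t‖ ^ 2 * (inner ℂ (X w) (H (v t))).re} := by
      unfold quadForm
      refine isClosed_le ?_ ?_ <;> fun_prop
    have h0 : (0 : ℝ) ∈ closure (Set.Ioi (0 : ℝ)) := by simp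
    have hmem := closure_minimal (fun t ht => hineq t ht) hcl h0
    have hv0 : v 0 = b := by simp [v]
    change 0 * quadForm X w * _ ≤ ‖v 0‖ ^ 2 * (inner ℂ (X w) (H (v 0))).re at hmem
    rw [hv0, zero_mul, zero_mul] at hmem
    rcases eq_or_ne b 0 with rfl | hb0
    · simp
    · exact nonneg_of_mul_nonneg_right hmem (by positivity)
  have hre0 := hre (-(X (H b)))
  rw [hX, inner_neg_left, Complex.neg_re, inner_self_eq_norm_sq_to_K] at hre0
  rw [← norm_eq_zero, ← sq_eq_zero_iff]
  refine le_antisymm ?_ (sq_nonneg _)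
  change 0 ≤ -(((‖X (H b)‖ : ℂ)) ^ 2).re at hre0
  rw [← Complex.ofReal_pow, Complex.ofReal_re] at hre0
  linarith

lemma exists_joint_eigenbasis {ι : Type*} {m : ℕ} (hm : Module.finrank ℂ E = m)
    {T : ι → E →ₗ[ℂ] E} (hT : ∀ l, (T l).IsSymmetric) (hC : ∀ k l, Commute (T k) (T l)) :
    ∃ (e : OrthonormalBasis (Fin m) ℂ E) (β : ι → Fin m → ℝ),
      ∀ l i, T l (e i) = (β l i : ℂ) • e i := by
  classical
  let V : (ι → ℂ) → Submodule ℂ E := fun χ => ⨅ j, Module.End.eigenspace (T j) (χ j)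
  have hV : DirectSum.IsInternal V :=
    LinearMap.IsSymmetric.directSum_isInternal_of_pairwise_commute hT fun i j _ => hC i j
  have hfin : {χ | V χ ≠ ⊥}.Finite :=
    WellFoundedGT.finite_ne_bot_of_iSupIndep hV.submodule_iSupIndep
  have : Fintype {χ // V χ ≠ ⊥} := hfin.fintype
  have hV' := DirectSum.isInternal_ne_bot_iff.2 hV
  have horth : OrthogonalFamily ℂ (fun χ : {χ // V χ ≠ ⊥} => V χ) fun χ => (V χ).subtypeₗᵢ :=
    (LinearMap.IsSymmetric.orthogonalFamily_iInf_eigenspaces hT).comp Subtype.val_injective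
  let e := hV'.subordinateOrthonormalBasis hm horth
  have he : ∀ l i, ∃ β : ℝ, T l (e i) = (β : ℂ) • e i := by
    intro l i
    have hmem := hV'.subordinateOrthonormalBasis_subordinate hm i horth
    have hl := (Submodule.mem_iInf _).1 hmem l
    have hev := Module.End.hasEigenvalue_of_hasEigenvector
      ⟨hl, (e.orthonormal.ne_zero i : e i ≠ 0)⟩
    rw [Module.End.mem_eigenspace_iff] at hl
    refine ⟨((hV'.subordinateOrthonormalBasisIndex hm i horth).1 l).re, ?_⟩
    rw [Complex.conj_eq_iff_re.1 ((hT l).conj_eigenvalue_eq_self hev)]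
    exact hl
  choose β hβ using he
  exact ⟨e, β, hβ⟩

end Maximizers

section Domination

variable {E : Type*} [NormedAddCommGroup E] [InnerProductSpace ℂ E]

lemma quadForm_sub_smul (X : E →ₗ[ℂ] E) (γ : ℝ) (v : E) :
    quadForm (X - (γ : ℂ) • LinearMap.id) v = quadForm X v - γ * ‖v‖ ^ 2 := by
  simp only [quadForm, LinearMap.sub_apply, LinearMap.smul_apply, LinearMap.id_apply,
    inner_sub_right, inner_smul_right, Complex.sub_re, Complex.re_ofReal_mul]
  rw [← inner_self_eq_norm_sq (𝕜 := ℂ) v]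
  rfl

lemma CovarianceNonneg.sub_smul {X H : E →ₗ[ℂ] E} (h : CovarianceNonneg X H) (γ : ℝ) :
    CovarianceNonneg (X - (γ : ℂ) • LinearMap.id) H := by
  intro v
  have hv := h v
  rw [quadForm_sub_smul]
  simp only [LinearMap.sub_apply, LinearMap.smul_apply, LinearMap.id_apply,
    inner_sub_left, inner_smul_left, Complex.conj_ofReal, Complex.sub_re, Complex.re_ofReal_mul]
  simp only [quadForm] at hv ⊢
  linarith

lemma quadForm_eigenbasis {m : ℕ} (e : OrthonormalBasis (Fin m) ℂ E) {T : E →ₗ[ℂ] E}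
    {τ : Fin m → ℝ} (hτ : ∀ i, T (e i) = (τ i : ℂ) • e i) (x : E) :
    quadForm T x = ∑ i, τ i * ‖inner ℂ (e i) x‖ ^ 2 := by
  have hT : T x = ∑ i, inner ℂ (e i) x • (τ i : ℂ) • e i := by
    conv_lhs => rw [← e.sum_repr' x]
    simp [hτ]
  rw [quadForm, hT]
  simp only [inner_sum, inner_smul_right, Complex.re_sum]
  refine Finset.sum_congr rfl fun i _ => ?_
  rw [mul_left_comm, Complex.re_ofReal_mul, ← inner_conj_symm x (e i), Complex.mul_conj',
    ← Complex.ofReal_pow, Complex.ofReal_re]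

lemma CovarianceNonneg.mul_sub_nonneg {m : ℕ} {X H : E →ₗ[ℂ] E} (h : CovarianceNonneg X H)
    (e : OrthonormalBasis (Fin m) ℂ E) {ξ η : Fin m → ℝ}
    (hξ : ∀ i, X (e i) = (ξ i : ℂ) • e i) (hη : ∀ i, H (e i) = (η i : ℂ) • e i) (p q : Fin m) :
    0 ≤ (ξ p - ξ q) * (η p - η q) := by
  rcases eq_or_ne p q with rfl | hpq
  · simp
  have hv := h (e p + e q)
  have hn : ‖e p + e q‖ ^ 2 = 2 := by
    rw [sq, norm_add_sq_eq_norm_sq_add_norm_sq_of_inner_eq_zero _ _ (e.orthonormal.2 hpq)]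
    norm_num
  rw [hn] at hv
  simp only [quadForm, map_add, hξ, hη, inner_add_left, inner_add_right, inner_smul_left,
    inner_smul_right, e.inner_eq_ite, hpq, hpq.symm] at hv
  simp at hv
  linarith

noncomputable def initialSpan {m : ℕ} (b : OrthonormalBasis (Fin m) ℂ E) (j : ℕ) :
    Submodule ℂ E :=
  Submodule.span ℂ (Set.range fun p : {p : Fin m // p.val ≤ j} => b p)

lemma mem_initialSpan_iff {m : ℕ} (b : OrthonormalBasis (Fin m) ℂ E) {j : ℕ} {x : E} :
    x ∈ initialSpan b j ↔ ∀ p : Fin m, j < p.val → inner ℂ (b p) x = 0 := by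
  constructor
  · intro hx p hp
    induction hx using Submodule.span_induction with
    | mem y hy =>
      obtain ⟨q, rfl⟩ := hy
      refine b.orthonormal.2 fun h => ?_
      have := q.2
      rw [← h] at this
      omega
    | zero => simp
    | add y z _ _ hy hz => rw [inner_add_right, hy, hz, add_zero]
    | smul a y _ hy => rw [inner_smul_right, hy, mul_zero]
  · intro h
    rw [← b.sum_repr' x]
    refine Submodule.sum_mem _ fun p _ => ?_
    rcases le_or_gt p.val j with hp | hp
    · exact Submodule.smul_mem _ _ (Submodule.subset_span ⟨⟨p, hp⟩, rfl⟩)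
    · simp [h p hp]

lemma inner_eq_zero_of_mem_orthogonal_initialSpan {m : ℕ} (b : OrthonormalBasis (Fin m) ℂ E)
    {j : ℕ} {y : E} (hy : y ∈ (initialSpan b j)ᗮ) {p : Fin m} (hp : p.val ≤ j) :
    inner ℂ (b p) y = 0 :=
  (Submodule.mem_orthogonal _ _).1 hy _ (Submodule.subset_span ⟨⟨p, hp⟩, rfl⟩)

lemma inner_eq_zero_of_eigenvalue_ne {X : E →ₗ[ℂ] E} (hX : X.IsSymmetric) {γ δ : ℝ} {u v : E}
    (hu : X u = (γ : ℂ) • u) (hv : X v = (δ : ℂ) • v) (h : γ ≠ δ) : inner ℂ u v = 0 := by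
  have := hX u v
  rw [hu, hv, inner_smul_left, inner_smul_right, Complex.conj_ofReal] at this
  by_contra h0
  exact h (by exact_mod_cast mul_right_cancel₀ h0 this)

lemma finrank_initialSpan {m : ℕ} (b : OrthonormalBasis (Fin m) ℂ E) {j : ℕ} (hj : j < m) :
    Module.finrank ℂ (initialSpan b j) = j + 1 := by
  have hli : LinearIndependent ℂ fun p : {p : Fin m // p.val ≤ j} => b p :=
    b.orthonormal.linearIndependent.comp _ Subtype.val_injective
  rw [initialSpan, finrank_span_eq_card hli, Fintype.card_subtype]
  have : (Finset.univ.filter fun p : Fin m => p.val ≤ j) = Finset.Iic ⟨j, hj⟩ := by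
    ext p; simp [Fin.le_def]
  rw [this, Fin.card_Iic]

lemma mem_initialSpan_map {m : ℕ} {b : OrthonormalBasis (Fin m) ℂ E} {c : Fin m → ℝ}
    (hc : Antitone c) {j : ℕ} (hj : j < m) (hj' : j + 1 < m) (hlt : c ⟨j + 1, hj'⟩ < c ⟨j, hj⟩)
    {A : E →ₗ[ℂ] E} (hA : Commute (diagOperator b c) A) {x : E} (hx : x ∈ initialSpan b j) :
    A x ∈ initialSpan b j := by
  induction hx using Submodule.span_induction with
  | mem y hy =>
    obtain ⟨⟨q, hq⟩, rfl⟩ := hy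
    refine (mem_initialSpan_iff b).2 fun p hp => ?_
    refine inner_eq_zero_of_eigenvalue_ne (isSymmetric_diagOperator b c)
      (diagOperator_basis b c p) (δ := c q) ?_ ?_
    · have := LinearMap.congr_fun hA.eq (b q)
      simpa [diagOperator_basis] using this
    · have h1 : c p ≤ c ⟨j + 1, hj'⟩ := hc (Fin.le_def.2 hp)
      have h2 : c ⟨j, hj⟩ ≤ c q := hc (Fin.le_def.2 hq)
      exact ((h1.trans_lt hlt).trans_le h2).ne
  | zero => simp
  | add y z _ _ hy hz => rw [map_add]; exact Submodule.add_mem _ hy hz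
  | smul a y _ hy => rw [map_smul]; exact Submodule.smul_mem _ _ hy

variable [FiniteDimensional ℂ E]

lemma CovarianceNonneg.apply_eq_smul {X H : E →ₗ[ℂ] E} (hX : X.IsSymmetric)
    (h : CovarianceNonneg X H) {γ : ℝ} {b : E} (hb : X b = (γ : ℂ) • b) :
    X (H b) = (γ : ℂ) • H b := by
  have hS : (X - (γ : ℂ) • LinearMap.id).IsSymmetric :=
    hX.sub (LinearMap.IsSymmetric.smul (by simp) LinearMap.IsSymmetric.id)
  have := (h.sub_smul γ).apply_eq_zero hS (b := b) (by simp [hb])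
  simpa [sub_eq_zero] using this

lemma CovarianceNonneg.commute {m : ℕ} {b : OrthonormalBasis (Fin m) ℂ E} {c : Fin m → ℝ}
    {H : E →ₗ[ℂ] E} (h : CovarianceNonneg (diagOperator b c) H) :
    Commute (diagOperator b c) H := by
  refine b.toBasis.ext fun q => ?_
  simp only [OrthonormalBasis.coe_toBasis, Module.End.mul_apply]
  rw [h.apply_eq_smul (isSymmetric_diagOperator b c) (diagOperator_basis b c q),
    diagOperator_basis, map_smul]

/-- The span of the first `j + 1` vectors of `b`. -/
lemma CovarianceNonneg.dominates {m : ℕ} {b : OrthonormalBasis (Fin m) ℂ E} {c : Fin m → ℝ}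
    (hc : Antitone c) {j : ℕ} (hj : j < m) (hj' : j + 1 < m) (hlt : c ⟨j + 1, hj'⟩ < c ⟨j, hj⟩)
    {H : E →ₗ[ℂ] E} (hH : H.IsSymmetric) (h : CovarianceNonneg (diagOperator b c) H) :
    Dominates H (initialSpan b j) := by
  have hm : Module.finrank ℂ E = m := by
    rw [Module.finrank_eq_card_basis b.toBasis, Fintype.card_fin]
  obtain ⟨e, β, hβ⟩ := exists_joint_eigenbasis hm (T := ![diagOperator b c, H])
    (by simp [Fin.forall_fin_two, hH, isSymmetric_diagOperator])
    (by simp [Fin.forall_fin_two, h.commute, h.commute.symm])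
  have hξ : ∀ i, diagOperator b c (e i) = (β 0 i : ℂ) • e i := hβ 0
  have hη : ∀ i, H (e i) = (β 1 i : ℂ) • e i := hβ 1
  intro x hx y hy
  have hx0 : ∀ i, β 0 i < c ⟨j, hj⟩ → inner ℂ (e i) x = 0 := fun i hi => by
    rw [← b.sum_repr' x, inner_sum]
    refine Finset.sum_eq_zero fun p _ => ?_
    rw [inner_smul_right]
    rcases le_or_gt p.val j with hp | hp
    · rw [inner_eq_zero_of_eigenvalue_ne (isSymmetric_diagOperator b c) (hξ i)
        (diagOperator_basis b c p), mul_zero]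
      exact (hi.trans_le (hc (Fin.le_def.2 hp))).ne
    · rw [(mem_initialSpan_iff b).1 hx p hp, zero_mul]
  have hy0 : ∀ i, c ⟨j + 1, hj'⟩ < β 0 i → inner ℂ (e i) y = 0 := fun i hi => by
    rw [← b.sum_repr' y, inner_sum]
    refine Finset.sum_eq_zero fun p _ => ?_
    rw [inner_smul_right]
    rcases le_or_gt p.val j with hp | hp
    · rw [inner_eq_zero_of_mem_orthogonal_initialSpan b hy hp, zero_mul]
    · rw [inner_eq_zero_of_eigenvalue_ne (isSymmetric_diagOperator b c) (hξ i)
        (diagOperator_basis b c p), mul_zero]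
      exact ((hc (Fin.le_def.2 hp) : c p ≤ c ⟨j + 1, hj'⟩).trans_lt hi).ne'
  rw [quadForm_eigenbasis e hη, quadForm_eigenbasis e hη, ← e.sum_sq_norm_inner_right x,
    ← e.sum_sq_norm_inner_right y, Finset.sum_mul_sum, Finset.sum_mul_sum, Finset.sum_comm]
  refine Finset.sum_le_sum fun p _ => Finset.sum_le_sum fun q _ => ?_
  rcases lt_or_ge (β 0 p) (c ⟨j, hj⟩) with hp | hp
  · simp [hx0 p hp]
  rcases lt_or_ge (c ⟨j + 1, hj'⟩) (β 0 q) with hq | hq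
  · simp [hy0 q hq]
  have hη' : β 1 q ≤ β 1 p :=
    sub_nonneg.1 (nonneg_of_mul_nonneg_right (h.mul_sub_nonneg e hξ hη p q) (by linarith))
  have := mul_le_mul_of_nonneg_right hη'
    (mul_nonneg (sq_nonneg ‖inner ℂ (e p) x‖) (sq_nonneg ‖inner ℂ (e q) y‖))
  linarith

end Domination

section FiniteMaximizers

variable {E : Type*} [NormedAddCommGroup E] [InnerProductSpace ℂ E]

/-- The operators of the pencil at which `b` maximizes the `c`-weighted form among all bases. -/
def maximizerCell {n : ℕ} (A B : E →ₗ[ℂ] E) (c : Fin n → ℝ) (b : OrthonormalBasis (Fin n) ℂ E) :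
    Set (ℝ × ℝ) :=
  {z | ∀ b' : OrthonormalBasis (Fin n) ℂ E, ∑ p, c p * quadForm (pencil A B z) (b' p) ≤
    ∑ p, c p * quadForm (pencil A B z) (b p)}

lemma isClosed_maximizerCell {n : ℕ} (A B : E →ₗ[ℂ] E) (c : Fin n → ℝ)
    (b : OrthonormalBasis (Fin n) ℂ E) : IsClosed (maximizerCell A B c b) := by
  simp only [maximizerCell, Set.ofPred_forall, quadForm_pencil]
  exact isClosed_iInter fun b' => isClosed_le (by fun_prop) (by fun_prop)

lemma iUnion_eq_univ_of_nonempty_interior {X ι : Type*} [TopologicalSpace X] [BaireSpace X]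
    [Finite ι] {K : ι → Set X} (hK : ∀ i, IsClosed (K i)) (hU : ⋃ i, K i = Set.univ) :
    ⋃ i : {i // (interior (K i)).Nonempty}, K i = Set.univ := by
  have hd := dense_iUnion_interior_of_closed hK hU
  refine Set.univ_subset_iff.1 ?_
  rw [← hd.closure_eq]
  refine closure_minimal (Set.iUnion_subset fun i x hx => ?_)
    (isClosed_iUnion_of_finite fun i => hK i)
  exact Set.mem_iUnion.2 ⟨⟨i, x, hx⟩, interior_subset hx⟩

lemma commute_of_commute_pencil {A B X : E →ₗ[ℂ] E} {S : Set (ℝ × ℝ)}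
    (hS : (interior S).Nonempty) (h : ∀ z ∈ S, Commute X (pencil A B z)) :
    Commute X A ∧ Commute X B := by
  let V : Submodule ℝ (ℝ × ℝ) :=
    { carrier := {z | Commute X (pencil A B z)}
      add_mem' := fun {z w} hz hw => by
        have : pencil A B (z + w) = pencil A B z + pencil A B w := by
          simp only [pencil, Prod.fst_add, Prod.snd_add, Complex.ofReal_add, add_smul]
          abel
        change Commute X (pencil A B (z + w))
        rw [this]
        exact Commute.add_right hz hw
      zero_mem' := by simp [pencil]
      smul_mem' := fun a z hz => by
        have : pencil A B (a • z) = (a : ℂ) • pencil A B z := by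
          simp only [pencil, Prod.smul_fst, Prod.smul_snd, smul_eq_mul, Complex.ofReal_mul,
            smul_add, mul_smul]
        change Commute X (pencil A B (a • z))
        rw [this]
        exact Commute.smul_right hz _ }
  have hV : V = ⊤ := Submodule.eq_top_of_nonempty_interior' V
    (hS.mono (interior_mono fun z hz => h z hz))
  have hmem : ∀ z, Commute X (pencil A B z) := fun z =>
    (hV ▸ Submodule.mem_top : z ∈ V)
  exact ⟨by simpa [pencil] using hmem (1, 0), by simpa [pencil] using hmem (0, 1)⟩

variable [FiniteDimensional ℂ E]

/-- If finitely many orthonormal bases suffice to maximize all the weighted forms of a Hermitian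
pencil, and the weights drop near the middle index, then the pencil is commutative. -/
theorem commute_of_finite_maximizers {n : ℕ} {ι : Type*} [Finite ι] {A B : E →ₗ[ℂ] E}
    (hA : A.IsSymmetric) (hB : B.IsSymmetric) {c : Fin n → ℝ} (hc : Antitone c) {j : ℕ}
    (hj : j < n) (hj' : j + 1 < n) (hlt : c ⟨j + 1, hj'⟩ < c ⟨j, hj⟩) (hlow : n ≤ 2 * (j + 1) + 2)
    (hup : 2 * (j + 1) ≤ n + 2) (b : ι → OrthonormalBasis (Fin n) ℂ E)
    (hb : ∀ z, ∃ i, z ∈ maximizerCell A B c (b i)) : A ∘ₗ B = B ∘ₗ A := by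
  obtain ⟨i₀, -⟩ := hb 0
  have hn : Module.finrank ℂ E = n := by
    rw [Module.finrank_eq_card_basis (b i₀).toBasis, Fintype.card_fin]
  have hU := iUnion_eq_univ_of_nonempty_interior
    (fun i => isClosed_maximizerCell A B c (b i))
    (Set.eq_univ_of_forall fun z => Set.mem_iUnion.2 (hb z))
  have hcov : ∀ i, ∀ z ∈ maximizerCell A B c (b i),
      CovarianceNonneg (diagOperator (b i) c) (pencil A B z) := fun i z hz =>
    covarianceNonneg_of_isMax (isSymmetric_pencil hA hB z) hz
  refine commute_of_dominates hA hB
    (R := fun i : {i // (interior (maximizerCell A B c (b i))).Nonempty} => initialSpan (b i) j)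
    (k := j + 1) (fun i x hx => ?_) (fun i => finrank_initialSpan (b i) hj) (fun z => ?_)
    (by omega) (by omega) (by omega) (by omega)
  · obtain ⟨h1, h2⟩ := commute_of_commute_pencil i.2 fun z hz => (hcov i z hz).commute
    exact ⟨mem_initialSpan_map hc hj hj' hlt h1 hx, mem_initialSpan_map hc hj hj' hlt h2 hx⟩
  · obtain ⟨i, hi⟩ := Set.mem_iUnion.1 (hU.symm ▸ Set.mem_univ z)
    exact ⟨i, (hcov i z hi).dominates hc hj hj' hlt (isSymmetric_pencil hA hB z)⟩

end FiniteMaximizers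

section NumericalRange

lemma inner_toEuclideanLin_eq {n : ℕ} (A V : Matrix (Fin n) (Fin n) ℂ) (i j : Fin n) :
    inner ℂ (WithLp.toLp 2 (V.col i)) (Matrix.toEuclideanLin A (WithLp.toLp 2 (V.col j))) =
      (star V * A * V) i j := by
  rw [Matrix.toLpLin_toLp, EuclideanSpace.inner_toLp_toLp, Matrix.toLin'_apply,
    Matrix.mul_assoc, Matrix.mul_apply, dotProduct]
  refine Finset.sum_congr rfl fun p _ => ?_
  simp [Matrix.mul_apply, Matrix.mulVec, dotProduct, Matrix.col, mul_comm]

lemma exists_orthonormalBasis_col {n : ℕ} {V : Matrix (Fin n) (Fin n) ℂ}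
    (hV : V ∈ Matrix.unitaryGroup (Fin n) ℂ) :
    ∃ b : OrthonormalBasis (Fin n) ℂ (EuclideanSpace ℂ (Fin n)),
      ∀ i, b i = WithLp.toLp 2 (V.col i) := by
  have hv : Orthonormal ℂ fun i => WithLp.toLp 2 (V.col i) := by
    rw [orthonormal_iff_ite]
    intro i j
    have := inner_toEuclideanLin_eq 1 V i j
    rw [Matrix.mul_one, Matrix.mem_unitaryGroup_iff'.1 hV] at this
    simpa [Matrix.one_apply] using this
  obtain ⟨b, hb⟩ := Orthonormal.exists_orthonormalBasis_extension_of_card_eq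
    (v := fun i => WithLp.toLp 2 (V.col i)) (s := Set.univ) (by simp)
    (hv.comp _ Subtype.val_injective)
  exact ⟨b, fun i => hb i trivial⟩

lemma exists_unitary_col {n : ℕ} (b : OrthonormalBasis (Fin n) ℂ (EuclideanSpace ℂ (Fin n))) :
    ∃ V ∈ Matrix.unitaryGroup (Fin n) ℂ, ∀ i, b i = WithLp.toLp 2 (V.col i) := by
  let V : Matrix (Fin n) (Fin n) ℂ := Matrix.of fun p i => b i p
  have hV : ∀ i, b i = WithLp.toLp 2 (V.col i) := fun i => rfl
  refine ⟨V, Matrix.mem_unitaryGroup_iff'.2 ?_, hV⟩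
  ext i j
  have := inner_toEuclideanLin_eq 1 V i j
  rw [Matrix.mul_one] at this
  rw [← this, ← hV, ← hV]
  simp [b.inner_eq_ite, Matrix.one_apply]

lemma mem_jointCNumRange_iff {n r : ℕ} {C U₀ : Matrix (Fin n) (Fin n) ℂ} {c : Fin n → ℝ}
    (hU₀ : U₀ ∈ Matrix.unitaryGroup (Fin n) ℂ)
    (hC : C = U₀ * Matrix.diagonal (fun i => (c i : ℂ)) * star U₀)
    (B : Fin r → Matrix (Fin n) (Fin n) ℂ) (p : Fin r → ℂ) :
    p ∈ jointCNumRange C B ↔ ∃ b : OrthonormalBasis (Fin n) ℂ (EuclideanSpace ℂ (Fin n)),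
      ∀ l, p l = ∑ i, (c i : ℂ) * inner ℂ (b i) (Matrix.toEuclideanLin (B l) (b i)) := by
  have key : ∀ V : Matrix (Fin n) (Fin n) ℂ, ∀ A,
      (C * (star (V * star U₀) * A * (V * star U₀))).trace =
        ∑ i, (c i : ℂ) * (star V * A * V) i i := by
    intro V A
    rw [hC, star_mul, star_star]
    have : U₀ * Matrix.diagonal (fun i => (c i : ℂ)) * star U₀ *
        (U₀ * star V * A * (V * star U₀)) =
        U₀ * (Matrix.diagonal (fun i => (c i : ℂ)) * (star V * A * V)) * star U₀ := by
      have h := Matrix.mem_unitaryGroup_iff'.1 hU₀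
      calc _ = U₀ * Matrix.diagonal (fun i => (c i : ℂ)) * (star U₀ * U₀) *
            (star V * A * V * star U₀) := by simp only [Matrix.mul_assoc]
        _ = _ := by rw [h]; simp only [Matrix.mul_assoc, Matrix.one_mul]
    rw [this, Matrix.trace_mul_cycle, Matrix.mem_unitaryGroup_iff'.1 hU₀, Matrix.one_mul]
    simp [Matrix.trace, Matrix.diagonal_mul]
  constructor
  · rintro ⟨U, hU, hp⟩
    obtain ⟨b, hb⟩ := exists_orthonormalBasis_col (mul_mem hU hU₀)
    refine ⟨b, fun l => ?_⟩
    have hUU : U * U₀ * star U₀ = U := by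
      rw [Matrix.mul_assoc, Matrix.mem_unitaryGroup_iff.1 hU₀, Matrix.mul_one]
    have := key (U * U₀) (B l)
    rw [hUU] at this
    simp only [hp, this, hb, inner_toEuclideanLin_eq]
  · rintro ⟨b, hb⟩
    obtain ⟨V, hV, hbV⟩ := exists_unitary_col b
    refine ⟨V * star U₀, mul_mem hV (Unitary.star_mem hU₀), fun l => ?_⟩
    simp only [hb, key, hbV, inner_toEuclideanLin_eq]

end NumericalRange

section PolyhedralRange

lemma commute_of_isPolyhedral {n r : ℕ} {C U₀ : Matrix (Fin n) (Fin n) ℂ} {c : Fin n → ℝ}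
    (hU₀ : U₀ ∈ Matrix.unitaryGroup (Fin n) ℂ)
    (hC : C = U₀ * Matrix.diagonal (fun i => (c i : ℂ)) * star U₀)
    {B : Fin r → Matrix (Fin n) (Fin n) ℂ} (hB : ∀ l, (B l).IsHermitian) (hc : Antitone c) {j : ℕ}
    (hj : j < n) (hj' : j + 1 < n) (hlt : c ⟨j + 1, hj'⟩ < c ⟨j, hj⟩) (hlow : n ≤ 2 * (j + 1) + 2)
    (hup : 2 * (j + 1) ≤ n + 2) (hW : IsPolyhedral (jointCNumRange C B)) (l l' : Fin r) :
    B l * B l' = B l' * B l := by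
  obtain ⟨F, hF, hWF⟩ := hW
  have hmem := mem_jointCNumRange_iff hU₀ hC B
  rw [hWF] at hmem
  have hsub : ∀ f : F, ∃ b : OrthonormalBasis (Fin n) ℂ (EuclideanSpace ℂ (Fin n)),
      ∀ l, f.1 l = ∑ i, (c i : ℂ) * inner ℂ (b i) (Matrix.toEuclideanLin (B l) (b i)) :=
    fun f => (hmem f).1 (subset_convexHull ℝ F f.2)
  choose b hb using hsub
  have : Finite F := hF
  have hsymm := fun l => Matrix.isSymmetric_toEuclideanLin_iff.2 (hB l)
  let φ : ℝ × ℝ → (Fin r → ℂ) →ₗ[ℝ] ℝ := fun z =>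
    z.1 • (Complex.reLm ∘ₗ LinearMap.proj l) + z.2 • (Complex.reLm ∘ₗ LinearMap.proj l')
  have hφ : ∀ z p (b' : OrthonormalBasis (Fin n) ℂ (EuclideanSpace ℂ (Fin n))),
      (∀ l, p l = ∑ i, (c i : ℂ) * inner ℂ (b' i) (Matrix.toEuclideanLin (B l) (b' i))) →
      φ z p = ∑ i, c i * quadForm (pencil (Matrix.toEuclideanLin (B l))
        (Matrix.toEuclideanLin (B l')) z) (b' i) := by
    intro z p b' hp
    simp only [φ, LinearMap.add_apply, LinearMap.smul_apply, LinearMap.comp_apply,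
      LinearMap.proj_apply, Complex.reLm_coe, hp, Complex.re_sum, Complex.re_ofReal_mul,
      quadForm_pencil, smul_eq_mul, Finset.mul_sum, ← Finset.sum_add_distrib]
    exact Finset.sum_congr rfl fun i _ => by simp only [quadForm]; ring
  have hne : F.Nonempty := by
    rw [← convexHull_nonempty_iff (𝕜 := ℝ)]
    exact ⟨_, (hmem _).2 ⟨EuclideanSpace.basisFun (Fin n) ℂ, fun l => rfl⟩⟩
  have hcover : ∀ z, ∃ f, z ∈ maximizerCell (Matrix.toEuclideanLin (B l))
      (Matrix.toEuclideanLin (B l')) c (b f) := by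
    intro z
    obtain ⟨f, hfF, hf⟩ := Set.exists_max_image F (φ z) hF hne
    refine ⟨⟨f, hfF⟩, fun b' => ?_⟩
    rw [← hφ z f _ (hb ⟨f, hfF⟩)]
    rw [← hφ z (fun l => ∑ i, (c i : ℂ) * inner ℂ (b' i) (Matrix.toEuclideanLin (B l) (b' i))) b'
      fun l => rfl]
    have hp := (hmem _).2 ⟨b', fun l => rfl⟩
    exact convexHull_min (t := {p | φ z p ≤ φ z f}) hf
      (convex_halfSpace_le (φ z).isLinear _) hp
  have hcomm := commute_of_finite_maximizers (hsymm l) (hsymm l') hc hj hj' hlt hlow hup b hcover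
  refine Matrix.toEuclideanLin.injective ?_
  refine LinearMap.ext fun x => ?_
  have := LinearMap.congr_fun hcomm x
  simp only [LinearMap.comp_apply] at this
  simpa [Matrix.toLpLin_apply, Matrix.mulVec_mulVec] using this

end PolyhedralRange

section SchurHorn

variable {E : Type*} [NormedAddCommGroup E] [InnerProductSpace ℂ E]

lemma sum_quadForm_eq {n : ℕ} (T : E →ₗ[ℂ] E) (f g : OrthonormalBasis (Fin n) ℂ E) :
    ∑ p, quadForm T (f p) = ∑ p, quadForm T (g p) := by
  simp only [quadForm, ← Complex.re_sum, ← LinearMap.trace_eq_sum_inner]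

lemma quadForm_neg (T : E →ₗ[ℂ] E) (x : E) : quadForm T (-x) = quadForm T x := by
  simp [quadForm]

lemma exists_orthonormalBasis_quadForm_eq {n : ℕ} (T : E →ₗ[ℂ] E)
    (f : OrthonormalBasis (Fin n) ℂ E) {i i' : Fin n} (hi : i ≠ i') {s : ℝ}
    (hs : s ∈ Set.uIcc (quadForm T (f i)) (quadForm T (f i'))) :
    ∃ g : OrthonormalBasis (Fin n) ℂ E, quadForm T (g i) = s ∧
      quadForm T (g i') = quadForm T (f i) + quadForm T (f i') - s ∧
      ∀ p, p ≠ i → p ≠ i' → quadForm T (g p) = quadForm T (f p) := by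
  let v : ℝ → E := fun t => (Real.cos t : ℂ) • f i + (Real.sin t : ℂ) • f i'
  have hv : ∀ t, ‖v t‖ = 1 := fun t => by
    have : ‖v t‖ ^ 2 = 1 := by
      have horth : inner ℂ ((Real.cos t : ℂ) • f i) ((Real.sin t : ℂ) • f i') = 0 := by
        rw [inner_smul_left, inner_smul_right, f.inner_eq_zero hi, mul_zero, mul_zero]
      rw [sq, norm_add_sq_eq_norm_sq_add_norm_sq_of_inner_eq_zero _ _ horth]
      simp only [norm_smul, Complex.norm_real, f.norm_eq_one, mul_one, Real.norm_eq_abs,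
        abs_mul_abs_self]
      linarith [Real.sin_sq_add_cos_sq t]
    exact (pow_eq_one_iff_of_nonneg (norm_nonneg _) two_ne_zero).1 this
  have hrefl : ∀ t x, Submodule.reflection (ℂ ∙ v t) x = (2 * inner ℂ (v t) x) • v t - x :=
    fun t x => by
      rw [Submodule.reflection_singleton_apply, hv]
      simp [two_smul, two_mul, add_smul]
  have hvi : ∀ t, inner ℂ (v t) (f i) = Real.cos t := fun t => by
    simp [v, f.inner_eq_ite, hi.symm, ← Complex.cos_conj]
  have hvp : ∀ t p, p ≠ i → p ≠ i' → inner ℂ (v t) (f p) = 0 := fun t p h h' => by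
    simp [v, f.inner_eq_ite, h.symm, h'.symm]
  let q : ℝ → ℝ := fun t => quadForm T ((2 * (Real.cos t : ℂ)) • v t - f i)
  have hT : ∀ t, T ((2 * (Real.cos t : ℂ)) • v t - f i) = (2 * (Real.cos t : ℂ)) •
      ((Real.cos t : ℂ) • T (f i) + (Real.sin t : ℂ) • T (f i')) - T (f i) := fun t => by
    simp only [v, map_sub, map_smul, map_add]
  have hq : Continuous q := by
    simp only [q, quadForm, hT, v]
    fun_prop
  have hq0 : q 0 = quadForm T (f i) := by
    simp [q, v, two_smul]
  have hq1 : q (Real.pi / 4) = quadForm T (f i') := by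
    have h2 : (2 * ((√2 : ℂ) / 2) * ((√2 : ℂ) / 2)) = 1 := by
      have : ((√2 : ℝ) : ℂ) * (√2 : ℝ) = 2 := by
        rw [← Complex.ofReal_mul, Real.mul_self_sqrt zero_le_two]; simp
      linear_combination this / 2
    simp only [q, v, Real.cos_pi_div_four, Real.sin_pi_div_four, smul_add, smul_smul]
    push_cast
    rw [h2, one_smul, one_smul, add_sub_cancel_left]
  rw [← hq0, ← hq1] at hs
  obtain ⟨t, -, ht⟩ := intermediate_value_uIcc hq.continuousOn hs
  let g := f.map (Submodule.reflection (ℂ ∙ v t))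
  have hgp : ∀ p, p ≠ i → p ≠ i' → quadForm T (g p) = quadForm T (f p) := fun p h h' => by
    simp [g, hrefl, hvp t p h h', quadForm_neg]
  have hgi : quadForm T (g i) = s := by
    rw [← ht]
    simp only [g, OrthonormalBasis.map_apply, hrefl, hvi, q]
  refine ⟨g, hgi, ?_, hgp⟩
  have hsum := sum_quadForm_eq T f g
  have hmem : i' ∈ Finset.univ.erase i := by simp [hi.symm]
  rw [← Finset.add_sum_erase _ _ (Finset.mem_univ i), ← Finset.add_sum_erase _ _ hmem,
    ← Finset.add_sum_erase _ _ (Finset.mem_univ i),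
    ← Finset.add_sum_erase _ (fun p => quadForm T (g p)) hmem, hgi] at hsum
  have hrest : ∑ p ∈ (Finset.univ.erase i).erase i', quadForm T (g p) =
      ∑ p ∈ (Finset.univ.erase i).erase i', quadForm T (f p) :=
    Finset.sum_congr rfl fun p hp => by
      simp only [Finset.mem_erase] at hp
      exact hgp p hp.2.1 hp.1
  linarith

lemma exists_perm_of_sum_eq {n : ℕ} {c d : Fin n → ℝ} (hc : ∀ p, c p = 0 ∨ c p = 1)
    (hd : ∀ p, d p = 0 ∨ d p = 1) (h : ∑ p, d p = ∑ p, c p) :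
    ∃ σ : Equiv.Perm (Fin n), ∀ i, d i = c (σ i) := by
  have hcard : ∀ x : Fin n → ℝ, (∀ p, x p = 0 ∨ x p = 1) →
      ∑ p, x p = Fintype.card {p // x p = 1} := fun x hx => by
    rw [Fintype.card_subtype, Finset.card_filter]
    push_cast
    exact Finset.sum_congr rfl fun p _ => by rcases hx p with h | h <;> simp [h]
  rw [hcard d hd, hcard c hc] at h
  let e : {p // d p = 1} ≃ {p // c p = 1} := Fintype.equivOfCardEq (by exact_mod_cast h)
  refine ⟨e.extendSubtype, fun i => ?_⟩
  by_cases hi : d i = 1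
  · rw [hi, e.extendSubtype_mem i hi]
  · rw [(hd i).resolve_right hi, (hc _).resolve_right (e.extendSubtype_not_mem i hi)]

lemma exists_ne_fractional {n : ℕ} {d : Fin n → ℝ} (h0 : ∀ p, 0 ≤ d p) (h1 : ∀ p, d p ≤ 1)
    {k : ℕ} (hd : ∑ p, d p = k) {i : Fin n} (hi0 : d i ≠ 0) (hi1 : d i ≠ 1) :
    ∃ i', i ≠ i' ∧ d i' ≠ 0 ∧ d i' ≠ 1 := by
  by_contra! hcon
  have hz : ∀ p, ∃ z : ℤ, i ≠ p → d p = z := fun p => by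
    by_cases hp : d p = 0
    · exact ⟨0, fun _ => by simp [hp]⟩
    · exact ⟨1, fun h => by simp [hcon p h hp]⟩
  choose z hz using hz
  rw [← Finset.add_sum_erase _ _ (Finset.mem_univ i), Finset.sum_congr rfl
    fun p hp => hz p (Finset.ne_of_mem_erase hp).symm] at hd
  have hdi : d i = ((k - ∑ p ∈ Finset.univ.erase i, z p : ℤ) : ℝ) := by
    push_cast
    linarith
  have hpos : 0 < d i := lt_of_le_of_ne (h0 i) (Ne.symm hi0)
  have hlt : d i < 1 := lt_of_le_of_ne (h1 i) hi1
  rw [hdi] at hpos hlt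
  have hpos' := Int.cast_pos.1 hpos
  have hlt' : (k - ∑ p ∈ Finset.univ.erase i, z p : ℤ) < 1 := by exact_mod_cast hlt
  omega

/-- The diagonals of an orthogonal projection in all orthonormal bases. -/
lemma exists_orthonormalBasis_diagonal_eq {n : ℕ} (b : OrthonormalBasis (Fin n) ℂ E)
    {c : Fin n → ℝ} (hc : ∀ p, c p = 0 ∨ c p = 1) {k : ℕ} (hk : ∑ p, c p = k) (d : Fin n → ℝ)
    (h0 : ∀ p, 0 ≤ d p) (h1 : ∀ p, d p ≤ 1) (hd : ∑ p, d p = k) :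
    ∃ f : OrthonormalBasis (Fin n) ℂ E, ∀ i, quadForm (diagOperator b c) (f i) = d i := by
  induction hN : (Finset.univ.filter fun p => d p ≠ 0 ∧ d p ≠ 1).card
    using Nat.strong_induction_on generalizing d with
  | _ N ih =>
  by_cases hfrac : ∃ i, d i ≠ 0 ∧ d i ≠ 1
  · obtain ⟨i, hi0, hi1⟩ := hfrac
    obtain ⟨i', hne, hi0', hi1'⟩ := exists_ne_fractional h0 h1 hd hi0 hi1
    obtain ⟨x, y, hxy, hx0, hx1, hy0, hy1, hint, hmem⟩ : ∃ x y : ℝ, x + y = d i + d i' ∧ 0 ≤ x ∧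
        x ≤ 1 ∧ 0 ≤ y ∧ y ≤ 1 ∧ ((y = 0 ∨ y = 1) ∨ (x = 0 ∨ x = 1)) ∧ d i ∈ Set.uIcc x y := by
      have := h0 i
      have := h0 i'
      have := h1 i
      have := h1 i'
      rcases le_total (d i + d i') 1 with h | h
      · refine ⟨d i + d i', 0, by ring, by linarith, h, le_rfl, zero_le_one, by simp, ?_⟩
        rw [Set.uIcc_of_ge (by linarith)]
        constructor <;> linarith
      · refine ⟨1, d i + d i' - 1, by ring, zero_le_one, le_rfl, by linarith, by linarith,
          by simp, ?_⟩
        rw [Set.uIcc_of_ge (by linarith)]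
        constructor <;> linarith
    let d' : Fin n → ℝ := Function.update (Function.update d i x) i' y
    have hd'i : d' i = x := by simp [d', hne]
    have hd'i' : d' i' = y := by simp [d']
    have hd'p : ∀ p, p ≠ i → p ≠ i' → d' p = d p := fun p h h' => by simp [d', h, h']
    have hbound : ∀ p, 0 ≤ d' p ∧ d' p ≤ 1 := fun p => by
      by_cases hp : p = i
      · rw [hp, hd'i]; exact ⟨hx0, hx1⟩
      by_cases hp' : p = i'
      · rw [hp', hd'i']; exact ⟨hy0, hy1⟩
      rw [hd'p p hp hp']; exact ⟨h0 p, h1 p⟩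
    have hsum : ∑ p, d' p = k := by
      have hmem : i' ∈ Finset.univ.erase i := by simp [hne.symm]
      rw [← hd, ← Finset.add_sum_erase _ _ (Finset.mem_univ i), ← Finset.add_sum_erase _ _ hmem,
        ← Finset.add_sum_erase _ d (Finset.mem_univ i),
        ← Finset.add_sum_erase _ d hmem, hd'i, hd'i', ← add_assoc, ← add_assoc, hxy]
      congr 1
      refine Finset.sum_congr rfl fun p hp => ?_
      simp only [Finset.mem_erase] at hp
      exact hd'p p hp.2.1 hp.1
    have hlt : (Finset.univ.filter fun p => d' p ≠ 0 ∧ d' p ≠ 1).card < N := by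
      rw [← hN]
      refine Finset.card_lt_card ((Finset.ssubset_iff_of_subset fun p hp => ?_).2 ?_)
      · by_cases hpi : p = i
        · simp [hpi, hi0, hi1]
        by_cases hpi' : p = i'
        · simp [hpi', hi0', hi1']
        simpa [hd'p p hpi hpi'] using hp
      · rcases hint with h | h
        · exact ⟨i', by simp [hi0', hi1'], by rcases h with h | h <;> simp [hd'i', h]⟩
        · exact ⟨i, by simp [hi0, hi1], by rcases h with h | h <;> simp [hd'i, h]⟩
    obtain ⟨f, hf⟩ := ih _ hlt d' (fun p => (hbound p).1) (fun p => (hbound p).2) hsum rfl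
    rw [← hd'i, ← hd'i', ← hf, ← hf] at hmem
    obtain ⟨g, hg, hg', hgp⟩ := exists_orthonormalBasis_quadForm_eq (diagOperator b c) f hne hmem
    refine ⟨g, fun p => ?_⟩
    by_cases hp : p = i
    · rw [hp, hg]
    by_cases hp' : p = i'
    · rw [hp', hg', hf, hf, hd'i, hd'i', hxy]; ring
    rw [hgp p hp hp', hf, hd'p p hp hp']
  · push Not at hfrac
    obtain ⟨σ, hσ⟩ := exists_perm_of_sum_eq hc
      (fun p => or_iff_not_imp_left.2 (hfrac p)) (hd.trans hk.symm)
    refine ⟨b.reindex σ.symm, fun i => ?_⟩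
    rw [hσ i, OrthonormalBasis.reindex_apply, Equiv.symm_symm, quadForm, diagOperator_basis,
      inner_smul_right, Complex.re_ofReal_mul, b.inner_eq_one]
    simp

/-- The averages of `c` over the bases of `E`, weighted by squared overlaps with the basis `e`. -/
def overlapAverages {n : ℕ} (e : OrthonormalBasis (Fin n) ℂ E) (c : Fin n → ℝ) :
    Set (Fin n → ℝ) :=
  {d | ∃ b : OrthonormalBasis (Fin n) ℂ E, ∀ i, d i = ∑ p, c p * ‖inner ℂ (e i) (b p)‖ ^ 2}

lemma overlapAverages_eq_convexHull {n : ℕ} (e : OrthonormalBasis (Fin n) ℂ E) {c : Fin n → ℝ}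
    (hc : ∀ p, c p = 0 ∨ c p = 1) {k : ℕ} (hk : ∑ p, c p = k) :
    overlapAverages e c =
      convexHull ℝ (Set.range fun σ : Equiv.Perm (Fin n) => fun i => c (σ i)) := by
  refine subset_antisymm ?_ ?_
  · rintro d ⟨b, hd⟩
    let D : Matrix (Fin n) (Fin n) ℝ := Matrix.of fun i p => ‖inner ℂ (e i) (b p)‖ ^ 2
    have hD : D ∈ doublyStochastic ℝ (Fin n) := by
      rw [mem_doublyStochastic_iff_sum]
      refine ⟨fun i p => sq_nonneg _, fun i => ?_, fun p => ?_⟩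
      · have := b.sum_sq_norm_inner_left (e i)
        rwa [e.norm_eq_one, one_pow] at this
      · have := e.sum_sq_norm_inner_right (b p)
        rwa [b.norm_eq_one, one_pow] at this
    have hDc : d = (Matrix.mulVecBilin ℝ ℝ).flip c D := by
      ext i
      simp [hd, D, Matrix.mulVec, dotProduct, mul_comm]
    rw [← SetLike.mem_coe, doublyStochastic_eq_convexHull_permMatrix] at hD
    rw [hDc]
    have := Set.mem_image_of_mem ((Matrix.mulVecBilin ℝ ℝ).flip c) hD
    rw [LinearMap.image_convexHull] at this
    refine convexHull_mono ?_ this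
    rintro _ ⟨_, ⟨σ, rfl⟩, rfl⟩
    exact ⟨σ, by ext i; simp [Matrix.permMatrix_mulVec]⟩
  · have hconv : Convex ℝ {d : Fin n → ℝ | (∀ p, 0 ≤ d p) ∧ (∀ p, d p ≤ 1) ∧ ∑ p, d p = k} := by
      intro x hx y hy s t hs ht hst
      refine ⟨fun p => ?_, fun p => ?_, ?_⟩
      · exact add_nonneg (mul_nonneg hs (hx.1 p)) (mul_nonneg ht (hy.1 p))
      · have h1 := mul_le_mul_of_nonneg_left (hx.2.1 p) hs
        have h2 := mul_le_mul_of_nonneg_left (hy.2.1 p) ht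
        simp only [Pi.add_apply, Pi.smul_apply, smul_eq_mul]
        linarith
      · simp only [Pi.add_apply, Pi.smul_apply, smul_eq_mul, Finset.sum_add_distrib,
          ← Finset.mul_sum, hx.2.2, hy.2.2]
        rw [← add_mul, hst, one_mul]
    intro d hd
    obtain ⟨h0, h1, hsum⟩ := convexHull_min (by
      rintro _ ⟨σ, rfl⟩
      refine ⟨fun p => ?_, fun p => ?_, ?_⟩
      · rcases hc (σ p) with h | h <;> simp [h]
      · rcases hc (σ p) with h | h <;> simp [h]
      · rw [← hk]; exact Equiv.sum_comp σ c) hconv hd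
    obtain ⟨f, hf⟩ := exists_orthonormalBasis_diagonal_eq e hc hk d h0 h1 hsum
    refine ⟨e.map (f.equiv e (Equiv.refl _)), fun i => ?_⟩
    rw [← hf, quadForm_eigenbasis e (diagOperator_basis e c)]
    refine Finset.sum_congr rfl fun p _ => ?_
    have : e i = f.equiv e (Equiv.refl _) (f i) := by simp
    rw [OrthonormalBasis.map_apply, this, LinearIsometryEquiv.inner_map_map, norm_inner_symm]

end SchurHorn

section CommutingFamilies

lemma sum_indicator_val_le {n j : ℕ} (hj : j < n) :
    ∑ p : Fin n, (if p.val ≤ j then (1 : ℝ) else 0) = (j + 1 : ℕ) := by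
  have : (Finset.univ.filter fun p : Fin n => p.val ≤ j) = Finset.Iic ⟨j, hj⟩ := by
    ext p; simp [Fin.le_def]
  rw [Finset.sum_boole, this, Fin.card_Iic]

lemma isPolyhedral_jointCNumRange {n r : ℕ} {c : Fin n → ℝ} (hc : ∀ p, c p = 0 ∨ c p = 1)
    {k : ℕ} (hk : ∑ p, c p = k) {B : Fin r → Matrix (Fin n) (Fin n) ℂ}
    (hB : ∀ l, (B l).IsHermitian) (hcomm : ∀ l l', Commute (B l) (B l')) :
    IsPolyhedral (jointCNumRange (Matrix.diagonal fun i => (c i : ℂ)) B) := by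
  have hsymm := fun l => Matrix.isSymmetric_toEuclideanLin_iff.2 (hB l)
  obtain ⟨e, β, hβ⟩ := exists_joint_eigenbasis (m := n) (by simp) hsymm
    fun l l' => LinearMap.ext fun x => by
      have := (hcomm l l').eq
      simp [Matrix.toLpLin_apply, Matrix.mulVec_mulVec, this]
  let L : (Fin n → ℝ) →ₗ[ℝ] (Fin r → ℂ) :=
    LinearMap.pi fun l => ∑ i, β l i • (Complex.ofRealCLM.toLinearMap ∘ₗ LinearMap.proj i)
  have hL : ∀ d l, L d l = ((∑ i, β l i * d i : ℝ) : ℂ) := fun d l => by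
    simp [L, LinearMap.sum_apply]
  have hval : ∀ (b : OrthonormalBasis (Fin n) ℂ (EuclideanSpace ℂ (Fin n))) l,
      ∑ p, (c p : ℂ) * inner ℂ (b p) (Matrix.toEuclideanLin (B l) (b p)) =
        L (fun i => ∑ p, c p * ‖inner ℂ (e i) (b p)‖ ^ 2) l := by
    intro b l
    have h : ∀ p, inner ℂ (b p) (Matrix.toEuclideanLin (B l) (b p)) =
        (quadForm (Matrix.toEuclideanLin (B l)) (b p) : ℂ) := fun p =>
      ((hsymm l).coe_re_inner_self_apply (b p)).symm
    simp only [h, quadForm_eigenbasis e (hβ l), hL]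
    norm_cast
    simp only [Finset.mul_sum]
    rw [Finset.sum_comm]
    exact Finset.sum_congr rfl fun i _ => Finset.sum_congr rfl fun p _ => by ring
  have hW : jointCNumRange (Matrix.diagonal fun i => (c i : ℂ)) B =
      L '' overlapAverages e c := by
    ext p
    rw [mem_jointCNumRange_iff (c := c) (one_mem (Matrix.unitaryGroup (Fin n) ℂ)) (by simp)]
    constructor
    · rintro ⟨b, hb⟩
      exact ⟨_, ⟨b, fun i => rfl⟩, funext fun l => by rw [hb, hval]⟩
    · rintro ⟨d, ⟨b, hb⟩, rfl⟩
      exact ⟨b, fun l => by rw [hval, ← funext hb]⟩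
  refine ⟨L '' Set.range fun σ : Equiv.Perm (Fin n) => fun i => c (σ i),
    (Set.finite_range _).image _, ?_⟩
  rw [hW, overlapAverages_eq_convexHull e hc hk, LinearMap.image_convexHull]

lemma commute_of_mem_span {R A : Type*} [CommSemiring R] [Semiring A] [Algebra R A] {S : Set A}
    (h : ∀ x ∈ S, ∀ y ∈ S, Commute x y) {x y : A} (hx : x ∈ Submodule.span R S)
    (hy : y ∈ Submodule.span R S) : Commute x y := by
  induction hx, hy using Submodule.span_induction₂ with
  | mem_mem x y hx hy => exact h x hx y hy
  | zero_left y _ => exact Commute.zero_left y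
  | zero_right x _ => exact Commute.zero_right x
  | add_left x y z _ _ _ hxz hyz => exact hxz.add_left hyz
  | add_right x y z _ _ _ hxy hxz => exact hxy.add_right hxz
  | smul_left a x y _ _ hxy => exact hxy.smul_left a
  | smul_right a x y _ _ hxy => exact hxy.smul_right a

open scoped Matrix.Norms.L2Operator in
lemma commute_star_of_commute_of_normal {n : ℕ} {X Y : Matrix (Fin n) (Fin n) ℂ}
    (hY : Y * star Y = star Y * Y) (h : Commute X Y) : Commute X (star Y) :=
  IsStarNormal.commute_star_right ⟨hY.symm⟩ h

lemma commute_of_mem_union_star {n : ℕ} {F : Set (Matrix (Fin n) (Fin n) ℂ)}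
    (hnormal : ∀ X ∈ F, X * star X = star X * X) (hcomm : ∀ X ∈ F, ∀ Y ∈ F, Commute X Y)
    {X Y : Matrix (Fin n) (Fin n) ℂ} (hX : X ∈ F ∪ star '' F) (hY : Y ∈ F ∪ star '' F) :
    Commute X Y := by
  have hstar : ∀ X ∈ F, ∀ Y ∈ F, Commute X (star Y) := fun X hX Y hY =>
    commute_star_of_commute_of_normal (hnormal Y hY) (hcomm X hX Y hY)
  rcases hX with hX | ⟨X, hX, rfl⟩ <;> rcases hY with hY | ⟨Y, hY, rfl⟩
  · exact hcomm X hX Y hY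
  · exact hstar X hX Y hY
  · exact (hstar Y hY X hX).symm
  · exact (hcomm X hX Y hY).star_star

end CommutingFamilies

theorem stmt_8 {n r : ℕ} (hn : 2 ≤ n)
    (F : Set (Matrix (Fin n) (Fin n) ℂ)) (hF : F.Nonempty)
    (B : Fin r → Matrix (Fin n) (Fin n) ℂ)
    (hBHerm : ∀ i, (B i).IsHermitian)
    (hBli : LinearIndependent ℂ B)
    (hBspan : Submodule.span ℂ (Set.range B) = Submodule.span ℂ (F ∪ star '' F)) :
    ((∀ X ∈ F, X * Xᴴ = Xᴴ * X) ∧ (∀ X ∈ F, ∀ Y ∈ F, X * Y = Y * X)) ↔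
      (∃ (C : Matrix (Fin n) (Fin n) ℂ) (c : Fin n → ℝ),
        Antitone c ∧
        (∃ U ∈ Matrix.unitaryGroup (Fin n) ℂ,
          C = U * Matrix.diagonal (fun i => (c i : ℂ)) * star U) ∧
        (∃ (j : ℕ) (hj : j + 1 < n),
          c ⟨j, by omega⟩ > c ⟨j + 1, hj⟩ ∧
          (n : ℝ) / 2 - 1 ≤ ((j : ℝ) + 1) ∧ ((j : ℝ) + 1) ≤ (n : ℝ) / 2 + 1) ∧
        IsPolyhedral (jointCNumRange C B)) := by
  constructor
  · rintro ⟨hnormal, hcomm⟩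
    have hB : ∀ l l', Commute (B l) (B l') := fun l l' =>
      commute_of_mem_span (R := ℂ)
        (fun X hX Y hY => commute_of_mem_union_star hnormal hcomm hX hY)
        (hBspan ▸ Submodule.subset_span ⟨l, rfl⟩) (hBspan ▸ Submodule.subset_span ⟨l', rfl⟩)
    let c : Fin n → ℝ := fun p => if p.val ≤ n / 2 - 1 then 1 else 0
    have hc : ∀ p, c p = 0 ∨ c p = 1 := fun p => by
      by_cases hp : p.val ≤ n / 2 - 1 <;> simp [c, hp]
    refine ⟨Matrix.diagonal fun i => (c i : ℂ), c, fun p q hpq => ?_,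
      ⟨1, one_mem _, by simp⟩, ⟨n / 2 - 1, by omega, by simp [c], ?_, ?_⟩,
      isPolyhedral_jointCNumRange hc (sum_indicator_val_le (by omega)) hBHerm hB⟩
    · have : p.val ≤ q.val := hpq
      simp only [c]
      split_ifs <;> first | omega | norm_num
    · have h : n ≤ 2 * (n / 2 - 1) + 4 := by omega
      have h' : (n : ℝ) ≤ 2 * (n / 2 - 1 : ℕ) + 4 := by exact_mod_cast h
      linarith
    · have h : 2 * (n / 2 - 1) ≤ n := by omega
      have h' : 2 * ((n / 2 - 1 : ℕ) : ℝ) ≤ n := by exact_mod_cast h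
      linarith
  · rintro ⟨C, c, hc, ⟨U₀, hU₀, hC⟩, ⟨j, hj, hlt, hlow, hup⟩, hW⟩
    have hlow' : (n : ℝ) ≤ 2 * (j + 1) + 2 := by linarith
    have hup' : 2 * ((j : ℝ) + 1) ≤ n + 2 := by linarith
    have hB := commute_of_isPolyhedral hU₀ hC hBHerm hc _ hj hlt (by exact_mod_cast hlow')
      (by exact_mod_cast hup') hW
    have hspan : ∀ X ∈ F ∪ star '' F, ∀ Y ∈ F ∪ star '' F, Commute X Y := fun X hX Y hY => by
      refine commute_of_mem_span (R := ℂ) (S := Set.range B) ?_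
        (hBspan ▸ Submodule.subset_span hX) (hBspan ▸ Submodule.subset_span hY)
      rintro _ ⟨l, rfl⟩ _ ⟨l', rfl⟩
      exact hB l l'
    exact ⟨fun X hX => hspan X (.inl hX) Xᴴ (.inr ⟨X, hX, rfl⟩),
      fun X hX Y hY => hspan X (.inl hX) Y (.inl hY)⟩
end

section
/- Let n_1, n_2 be positive integers with n = n_1 + n_2, and let k be an integer with 1 ≤ k ≤ n. Let P ∈ M_n be a rank-k orthogonal projection written in block form P = [[P_{11}, P_{12}], [P_{12}*, P_{22}]] with P_{11} ∈ M_{n_1} and P_{22} ∈ M_{n_2}. Then the block diagonal matrix P_{11} ⊕ P_{22} is a convex combination of rank-k orthogonal projections of the form Q_1 ⊕ Q_2, where Q_1 ∈ M_{n_1} and Q_2 ∈ M_{n_2} are orthogonal projections. -/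
open Matrix

/-- Every point of the hypersimplex is a convex combination of `0`-`1` vectors with the same
coordinate sum. -/
theorem mem_convexHull_zero_one_of_sum_eq_natCast {ι : Type*} [Fintype ι] {k : ℕ} {d : ι → ℝ}
    (h0 : ∀ i, 0 ≤ d i) (h1 : ∀ i, d i ≤ 1) (hsum : ∑ i, d i = k) :
    d ∈ convexHull ℝ {v : ι → ℝ | (∀ i, v i = 0 ∨ v i = 1) ∧ ∑ i, v i = k} := by
  classical
  set S : Set (ι → ℝ) := {v | (∀ i, v i = 0 ∨ v i = 1) ∧ ∑ i, v i = k}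
  set H : Set (ι → ℝ) := Set.Icc 0 1 ∩ {v | ∑ i, v i = k}
  have hcomp : IsCompact H := isCompact_Icc.inter_right
    (isClosed_eq (by fun_prop) continuous_const)
  have hconv : Convex ℝ H := by
    refine (convex_Icc 0 1).inter fun x hx y hy a b _ _ hab => ?_
    simp only [Set.mem_ofPred_eq] at hx hy ⊢
    simp [Finset.sum_add_distrib, ← Finset.mul_sum, hx, hy, ← add_mul, hab]
  have hfin : S.Finite := by
    refine (Set.Finite.pi' fun _ : ι => Set.toFinite ({0, 1} : Set ℝ)).subset ?_
    rintro v ⟨hv, -⟩ i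
    simpa using hv i
  have hext : H.extremePoints ℝ ⊆ S := by
    intro x hx
    obtain ⟨⟨⟨hx0, hx1⟩, hxs⟩, hxe⟩ := mem_extremePoints_iff_left.1 hx
    have hxs : ∑ i, x i = k := hxs
    refine ⟨?_, hxs⟩
    by_contra! hcon
    obtain ⟨i, hi0, hi1⟩ := hcon
    have hex : ∃ j, j ≠ i ∧ x j ≠ 0 ∧ x j ≠ 1 := by
      by_contra! hj
      have hnat : ∀ j, j ≠ i → ∃ m : ℕ, x j = m := by
        intro j hji
        by_cases h : x j = 0
        · exact ⟨0, by simpa using h⟩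
        · exact ⟨1, by simpa using hj j hji h⟩
      choose! m hm using hnat
      rw [← Finset.add_sum_erase _ _ (Finset.mem_univ i),
        Finset.sum_congr rfl (fun j hj => hm j (Finset.ne_of_mem_erase hj)), ← Nat.cast_sum] at hxs
      have hlt0 : 0 < x i := lt_of_le_of_ne (hx0 i) (Ne.symm hi0)
      have hlt1 : x i < 1 := lt_of_le_of_ne (hx1 i) hi1
      set s := ∑ j ∈ Finset.univ.erase i, m j
      have ha : s < k := by exact_mod_cast (by linarith : (s : ℝ) < k)
      have hb : k < s + 1 := by exact_mod_cast (by linarith : (k : ℝ) < s + 1)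
      omega
    obtain ⟨j, hji, hj0, hj1⟩ := hex
    have hpos : ∀ l, x l ≠ 0 → 0 < x l := fun l h => lt_of_le_of_ne (hx0 l) (Ne.symm h)
    have hlt : ∀ l, x l ≠ 1 → 0 < 1 - x l := fun l h => sub_pos.2 (lt_of_le_of_ne (hx1 l) h)
    obtain ⟨ε, hε, hεl⟩ : ∃ ε > 0, ε < x i ∧ ε < x j ∧ ε < 1 - x i ∧ ε < 1 - x j := by
      obtain ⟨ε, hε, hεl⟩ := exists_between (lt_min (lt_min (hpos i hi0) (hpos j hj0))
        (lt_min (hlt i hi1) (hlt j hj1)))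
      simp only [lt_min_iff] at hεl
      exact ⟨ε, hε, by tauto⟩
    have hmem : ∀ δ : ℝ, |δ| ≤ ε → x + (Pi.single i δ - Pi.single j δ) ∈ H := by
      intro δ hδ
      rw [abs_le] at hδ
      refine ⟨⟨fun l => ?_, fun l => ?_⟩, ?_⟩
      · have := hx0 l
        simp only [Pi.zero_apply, Pi.add_apply, Pi.sub_apply, Pi.single_apply] at this ⊢
        split_ifs <;> subst_vars <;> linarith
      · have := hx1 l
        simp only [Pi.one_apply, Pi.add_apply, Pi.sub_apply, Pi.single_apply] at this ⊢
        split_ifs <;> subst_vars <;> linarith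
      · simp [Finset.sum_add_distrib, Finset.sum_sub_distrib, hxs]
    have heq := hxe _ (hmem ε (abs_of_pos hε).le) _ (hmem (-ε) (by simp [abs_of_pos hε]))
      ⟨1 / 2, 1 / 2, by norm_num, by norm_num, by norm_num, by
        ext l
        simp only [Pi.add_apply, Pi.smul_apply, Pi.sub_apply, Pi.single_neg, Pi.neg_apply,
          smul_eq_mul]
        ring⟩
    have := congrFun heq i
    simp [hji.symm, hε.ne'] at this
  have hd : d ∈ H := ⟨⟨h0, h1⟩, hsum⟩
  rw [← closure_convexHull_extremePoints hcomp hconv] at hd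
  exact convexHull_mono hext (((hfin.subset hext).isClosed_convexHull ℝ).closure_eq ▸ hd)

/-- The rank of an idempotent matrix over a field is its trace. -/
theorem IsIdempotentElem.matrix_trace_eq_rank {K ι : Type*} [Field K] [Fintype ι] [DecidableEq ι]
    {A : Matrix ι ι K} (hA : IsIdempotentElem A) : A.trace = A.rank := by
  have h : IsIdempotentElem (toLin' A) := by
    rw [IsIdempotentElem, Module.End.mul_eq_comp, ← toLin'_mul, hA.eq]
  rw [← trace_toLin'_eq, ((LinearMap.isProj_range_iff_isIdempotentElem _).2 h).trace]
  rfl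

open scoped ComplexOrder in
/-- A positive semidefinite contraction is the image of a vector with entries in `[0, 1]` under a real-linear
functional calculus sending `0`-`1` vectors to orthogonal projections. -/
theorem exists_linearMap_diagonalization {ι : Type*} [Fintype ι] [DecidableEq ι]
    {A : Matrix ι ι ℂ} (hA : A.PosSemidef) (hA' : (1 - A).PosSemidef) :
    ∃ (φ : (ι → ℝ) →ₗ[ℝ] Matrix ι ι ℂ) (d : ι → ℝ), (∀ i, 0 ≤ d i) ∧ (∀ i, d i ≤ 1) ∧
      φ d = A ∧ (∀ v, (φ v).IsHermitian) ∧ (∀ v, (φ v).trace = ((∑ i, v i : ℝ) : ℂ)) ∧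
      ∀ v, (∀ i, v i = 0 ∨ v i = 1) → φ v * φ v = φ v := by
  set U := hA.1.eigenvectorUnitary
  set c := Unitary.conjStarAlgAut ℂ (Matrix ι ι ℂ) U with hc
  have hspec : A = c (diagonal (Complex.ofReal ∘ hA.1.eigenvalues)) := hA.1.spectral_theorem
  let D : (ι → ℝ) →ₗ[ℝ] Matrix ι ι ℂ :=
    { toFun := fun v => diagonal fun i => (v i : ℂ)
      map_add' := fun v w => by simp [diagonal_add]
      map_smul' := fun r v => by ext i j; by_cases h : i = j <;> simp [h] }
  refine ⟨(c.toAlgEquiv.toLinearMap.restrictScalars ℝ) ∘ₗ D, hA.1.eigenvalues,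
    hA.eigenvalues_nonneg, ?_, hspec.symm, fun v => ?_, fun v => ?_, fun v hv => ?_⟩
  · have h2 : star (U : Matrix ι ι ℂ) * (1 - A) * U
        = diagonal fun i => ((1 - hA.1.eigenvalues i : ℝ) : ℂ) := by
      rw [← Unitary.conjStarAlgAut_symm_apply (S := ℂ), ← hc, StarAlgEquiv.symm_apply_eq]
      nth_rewrite 1 [hspec]
      rw [← map_one c, ← map_sub, ← diagonal_one, diagonal_sub]
      simp
    have h3 := hA'.conjTranspose_mul_mul_same (U : Matrix ι ι ℂ)
    rw [← star_eq_conjTranspose, h2, posSemidef_diagonal_iff] at h3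
    intro i
    have := h3 i
    rw [Complex.zero_le_real] at this
    linarith
  · change star (c (D v)) = c (D v)
    rw [← map_star, star_eq_conjTranspose]
    simp [D, diagonal_conjTranspose, Pi.star_def]
  · change (c (D v)).trace = _
    rw [hc, Unitary.conjStarAlgAut_apply, trace_mul_comm, ← mul_assoc]
    simp [D, trace_diagonal]
  · change c (D v) * c (D v) = c (D v)
    rw [← map_mul]
    congr 1
    simp only [D, LinearMap.coe_mk, AddHom.coe_mk, diagonal_mul_diagonal]
    congr 1
    ext i
    rcases hv i with h | h <;> simp [h]

open scoped ComplexOrder in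
/-- The diagonalization of a positive semidefinite contraction, for a principal submatrix of an
orthogonal projection. -/
theorem exists_linearMap_diagonalization_submatrix {ι κ : Type*} [Fintype ι] [DecidableEq ι]
    [Fintype κ] [DecidableEq κ] {P : Matrix κ κ ℂ} (hPH : P.IsHermitian) (hPP : P * P = P)
    {f : ι → κ} (hf : Function.Injective f) :
    ∃ (φ : (ι → ℝ) →ₗ[ℝ] Matrix ι ι ℂ) (d : ι → ℝ), (∀ i, 0 ≤ d i) ∧ (∀ i, d i ≤ 1) ∧
      φ d = P.submatrix f f ∧ (∀ v, (φ v).IsHermitian) ∧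
      (∀ v, (φ v).trace = ((∑ i, v i : ℝ) : ℂ)) ∧
      ∀ v, (∀ i, v i = 0 ∨ v i = 1) → φ v * φ v = φ v := by
  have hP : P.PosSemidef := by
    have h := posSemidef_conjTranspose_mul_self P
    rwa [hPH.eq, hPP] at h
  have hP' : (1 - P).PosSemidef := by
    have h := posSemidef_conjTranspose_mul_self (1 - P)
    rwa [conjTranspose_sub, conjTranspose_one, hPH.eq, (IsIdempotentElem.one_sub hPP).eq] at h
  have hsub := hP'.submatrix f
  rw [submatrix_sub, Pi.sub_apply, Pi.sub_apply, submatrix_one f hf] at hsub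
  exact exists_linearMap_diagonalization (hP.submatrix f) hsub

theorem stmt_15 {n₁ n₂ : ℕ} (h₁ : 0 < n₁) (h₂ : 0 < n₂)
    (k : ℕ) (hk1 : 1 ≤ k) (hk2 : k ≤ n₁ + n₂)
    (P : Matrix (Fin n₁ ⊕ Fin n₂) (Fin n₁ ⊕ Fin n₂) ℂ)
    (hPH : P.IsHermitian) (hPP : P * P = P) (hPrank : P.rank = k) :
    ∃ (t : ℕ) (w : Fin t → ℝ)
      (Q₁ : Fin t → Matrix (Fin n₁) (Fin n₁) ℂ)
      (Q₂ : Fin t → Matrix (Fin n₂) (Fin n₂) ℂ),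
      (∀ i, 0 ≤ w i) ∧ (∑ i, w i = 1) ∧
      (∀ i, (Q₁ i).IsHermitian ∧ Q₁ i * Q₁ i = Q₁ i ∧
            (Q₂ i).IsHermitian ∧ Q₂ i * Q₂ i = Q₂ i ∧
            (Matrix.fromBlocks (Q₁ i) 0 0 (Q₂ i)).rank = k) ∧
      Matrix.fromBlocks P.toBlocks₁₁ 0 0 P.toBlocks₂₂ =
        ∑ i, w i • Matrix.fromBlocks (Q₁ i) 0 0 (Q₂ i) := by
  obtain ⟨φ₁, d₁, hd₁0, hd₁1, hφd₁, hφ₁H, hφ₁t, hφ₁i⟩ :=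
    exists_linearMap_diagonalization_submatrix hPH hPP (Sum.inl_injective (β := Fin n₂))
  obtain ⟨φ₂, d₂, hd₂0, hd₂1, hφd₂, hφ₂H, hφ₂t, hφ₂i⟩ :=
    exists_linearMap_diagonalization_submatrix hPH hPP (Sum.inr_injective (α := Fin n₁))
  have hsum : ∑ i, Sum.elim d₁ d₂ i = k := by
    have h := IsIdempotentElem.matrix_trace_eq_rank hPP
    have h' : P.trace = (P.submatrix Sum.inl Sum.inl).trace
        + (P.submatrix Sum.inr Sum.inr).trace := by
      simp [Matrix.trace, Fintype.sum_sum_type]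
    rw [h', ← hφd₁, ← hφd₂, hφ₁t, hφ₂t, hPrank] at h
    rw [Fintype.sum_sum_type]
    exact_mod_cast h
  have hmem := mem_convexHull_zero_one_of_sum_eq_natCast (d := Sum.elim d₁ d₂)
    (by rintro (i | i) <;> simp [hd₁0, hd₂0]) (by rintro (i | i) <;> simp [hd₁1, hd₂1]) hsum
  obtain ⟨τ, _, w, z, hw0, hw1, hz, hwz⟩ := mem_convexHull_iff_exists_fintype.1 hmem
  let e := (Fintype.equivFin τ).symm
  refine ⟨Fintype.card τ, w ∘ e, fun i => φ₁ (z (e i) ∘ Sum.inl), fun i => φ₂ (z (e i) ∘ Sum.inr),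
    fun i => hw0 _, ?_, fun i => ?_, ?_⟩
  · rw [← hw1]
    exact e.sum_comp w
  · obtain ⟨hz01, hzs⟩ := hz (e i)
    have hi₁ := hφ₁i (z (e i) ∘ Sum.inl) fun j => hz01 _
    have hi₂ := hφ₂i (z (e i) ∘ Sum.inr) fun j => hz01 _
    refine ⟨hφ₁H _, hi₁, hφ₂H _, hi₂, ?_⟩
    have hI : IsIdempotentElem (fromBlocks (φ₁ (z (e i) ∘ Sum.inl)) 0 0
        (φ₂ (z (e i) ∘ Sum.inr))) := by
      simp [IsIdempotentElem, fromBlocks_multiply, hi₁, hi₂]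
    have h := hI.matrix_trace_eq_rank
    have ht : ∀ (A : Matrix (Fin n₁) (Fin n₁) ℂ) (B : Matrix (Fin n₂) (Fin n₂) ℂ),
        (fromBlocks A 0 0 B).trace = A.trace + B.trace := fun A B => by
      simp [Matrix.trace, Fintype.sum_sum_type]
    rw [ht, hφ₁t, hφ₂t, ← Complex.ofReal_add] at h
    rw [Fintype.sum_sum_type] at hzs
    simp only [Function.comp_apply, hzs] at h
    exact_mod_cast h.symm
  · have hcomp₁ : d₁ = ∑ i, w i • (z i ∘ Sum.inl) := by
      ext j; simpa using (congrFun hwz (Sum.inl j)).symm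
    have hcomp₂ : d₂ = ∑ i, w i • (z i ∘ Sum.inr) := by
      ext j; simpa using (congrFun hwz (Sum.inr j)).symm
    have hb₁ : P.toBlocks₁₁ = ∑ i, w i • φ₁ (z i ∘ Sum.inl) := by
      rw [show P.toBlocks₁₁ = φ₁ d₁ from hφd₁.symm, hcomp₁]
      simp
    have hb₂ : P.toBlocks₂₂ = ∑ i, w i • φ₂ (z i ∘ Sum.inr) := by
      rw [show P.toBlocks₂₂ = φ₂ d₂ from hφd₂.symm, hcomp₂]
      simp
    refine Eq.trans ?_ (e.sum_comp
      fun i => w i • fromBlocks (φ₁ (z i ∘ Sum.inl)) 0 0 (φ₂ (z i ∘ Sum.inr))).symm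
    rw [hb₁, hb₂]
    ext (a | a) (b | b) <;> simp [Matrix.sum_apply]
end
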